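/- arXiv:2106.06961 — 3 statements merged into one kernel-verified Lean document; each statement's English description precedes it below -/
import Mathlib

section
/- Let n ≥ 1 and let U_1, U_2 be disjoint compact connected subsets of the closed unit ball B^n ⊂ R^n, each with non-empty interior, with n-dimensional Lebesgue measures μ_1 = m_n(U_1) ≥ μ_2 = m_n(U_2) > 0. Let Z = ∂U_1 ∪ ∂U_2. Then every real polynomial P of degree at most 2 in n variables satisfies sup_{B^n} |P| ≤ (4n/μ_2)^2 · sup_Z |P|. -/
open Metric MeasureTheory

/-- The volume of the Euclidean unit ball of dimension `m`. -/
noncomputable def unitBallVolume (m : ℕ) : ℝ := √Real.pi ^ m / Real.Gamma ((m : ℝ) / 2 + 1)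

theorem unitBallVolume_nonneg (m : ℕ) : 0 ≤ unitBallVolume m := by
  unfold unitBallVolume
  have : 0 < Real.Gamma ((m : ℝ) / 2 + 1) := Real.Gamma_pos_of_pos (by positivity)
  positivity

theorem unitBallVolume_zero : unitBallVolume 0 = 1 := by
  simp [unitBallVolume]

theorem unitBallVolume_one : unitBallVolume 1 = 2 := by
  have h : Real.Gamma ((1 : ℝ) / 2 + 1) = 1 / 2 * √Real.pi := by
    rw [Real.Gamma_add_one (by norm_num), Real.Gamma_one_half_eq]
  have : √Real.pi ≠ 0 := by positivity
  simp only [unitBallVolume, Nat.cast_one, h, pow_one]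
  field_simp

theorem unitBallVolume_add_two (m : ℕ) :
    unitBallVolume (m + 2) = 2 * Real.pi / (m + 2) * unitBallVolume m := by
  have h : Real.Gamma (((m + 2 : ℕ) : ℝ) / 2 + 1) =
      ((m : ℝ) / 2 + 1) * Real.Gamma ((m : ℝ) / 2 + 1) := by
    rw [← Real.Gamma_add_one (by positivity)]
    push_cast
    congr 1
    ring
  have h' : Real.Gamma ((m : ℝ) / 2 + 1) ≠ 0 := (Real.Gamma_pos_of_pos (by positivity)).ne'
  simp only [unitBallVolume, h, pow_add, Real.sq_sqrt Real.pi_pos.le]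
  field_simp

theorem unitBallVolume_le (m : ℕ) : unitBallVolume m ≤ Real.pi / 3 * (m + 1) := by
  have hpi := Real.pi_gt_three
  induction m using Nat.twoStepInduction with
  | zero => rw [unitBallVolume_zero]; push_cast; linarith
  | one => rw [unitBallVolume_one]; push_cast; linarith
  | more k ih _ =>
    have h4 := Real.pi_lt_d2
    rw [unitBallVolume_add_two]
    push_cast
    rw [div_mul_eq_mul_div, div_le_iff₀ (by positivity)]
    rcases Nat.lt_or_ge k 2 with hk | hk
    · interval_cases k
      · rw [unitBallVolume_zero]; norm_num; nlinarith
      · rw [unitBallVolume_one]; norm_num; nlinarith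
    · have hk' : (2 : ℝ) ≤ k := by exact_mod_cast hk
      have h1 : 2 * Real.pi * unitBallVolume k ≤ 2 * Real.pi * (Real.pi / 3 * (k + 1)) := by
        gcongr
      have h2 : 2 * Real.pi * (k + 1) ≤ (k + 3) * (k + 2) := by nlinarith
      nlinarith

theorem volume_closedBall_eq_unitBallVolume (m : ℕ) (x : EuclideanSpace ℝ (Fin m)) {R : ℝ}
    (hR : 0 ≤ R) : volume (closedBall x R) = ENNReal.ofReal (R ^ m * unitBallVolume m) := by
  cases m with
  | zero =>
    have h : closedBall x R = Set.univ := by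
      ext y
      simp [Subsingleton.elim y x, hR]
    rw [h, unitBallVolume_zero, ← (PiLp.volume_preserving_toLp (Fin 0)).measure_preimage
      MeasurableSet.univ.nullMeasurableSet]
    simp [volume_pi]
  | succ m =>
    rw [EuclideanSpace.volume_closedBall, ENNReal.ofReal_mul (by positivity),
      ENNReal.ofReal_pow hR]
    simp [unitBallVolume]

/-- If `g` vanishes off a ball and its integral along each line parallel to `u` is at most `ℓ`,
then its total integral is at most `ℓ` times the volume of the equatorial section of the ball. -/
theorem lintegral_le_of_forall_line {m : ℕ} {g : EuclideanSpace ℝ (Fin (m + 1)) → ENNReal}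
    (hg : Measurable g) (c : EuclideanSpace ℝ (Fin (m + 1))) {R : ℝ} (hR : 0 ≤ R)
    (hgR : ∀ w, R < ‖w - c‖ → g w = 0) {u : EuclideanSpace ℝ (Fin (m + 1))} (hu : ‖u‖ = 1)
    {ℓ : ℝ} (hℓ : ∀ p, ∫⁻ t : ℝ, g (p + t • u) ≤ ENNReal.ofReal ℓ) :
    ∫⁻ w, g w ≤ ENNReal.ofReal (unitBallVolume m * R ^ m * ℓ) := by
  obtain ⟨b, hb⟩ := Orthonormal.exists_orthonormalBasis_extension_of_card_eq
    (𝕜 := ℝ) (E := EuclideanSpace ℝ (Fin (m + 1))) (ι := Fin (m + 1)) (by simp)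
    (v := fun _ => u) (s := {0}) (by
      rw [orthonormal_iff_ite]
      rintro ⟨i, rfl⟩ ⟨j, rfl⟩
      simp [hu])
  have hb0 : b 0 = u := hb 0 rfl
  set Φ : ℝ × (Fin m → ℝ) → EuclideanSpace ℝ (Fin (m + 1)) := fun z =>
    c + b.repr.symm (WithLp.toLp 2 ((MeasurableEquiv.piFinSuccAbove (fun _ => ℝ) 0).symm z))
    with hΦ
  have hΦm : MeasurePreserving Φ volume volume :=
    (measurePreserving_add_left volume c).comp (b.measurePreserving_repr_symm.comp
      ((PiLp.volume_preserving_toLp (Fin (m + 1))).comp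
        ((volume_preserving_piFinSuccAbove (fun _ => ℝ) 0).symm _)))
  have hline : ∀ t y, Φ (t, y) = Φ (0, y) + t • u := by
    intro t y
    simp only [hΦ, add_assoc, ← hb0]
    congr 1
    apply b.repr.injective
    ext i
    refine Fin.cases ?_ (fun j => ?_) i <;>
      simp [MeasurableEquiv.piFinSuccAbove, Fin.insertNthEquiv]
  have hnorm : ∀ t y, ‖WithLp.toLp 2 y‖ ≤ ‖Φ (t, y) - c‖ := by
    intro t y
    simp only [hΦ, add_sub_cancel_left, LinearIsometryEquiv.norm_map]
    rw [EuclideanSpace.norm_eq, EuclideanSpace.norm_eq]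
    apply Real.sqrt_le_sqrt
    simp [MeasurableEquiv.piFinSuccAbove, Fin.insertNthEquiv, Fin.sum_univ_succ]
    positivity
  rw [← hΦm.lintegral_comp hg]
  change ∫⁻ z, g (Φ z) ∂(volume.prod volume) ≤ _
  rw [lintegral_prod_symm (fun z => g (Φ z)) (hg.comp hΦm.measurable).aemeasurable]
  have hsec : ∀ y, ∫⁻ t, g (Φ (t, y)) ≤
      (WithLp.toLp 2 ⁻¹' closedBall (0 : EuclideanSpace ℝ (Fin m)) R).indicator
        (fun _ => ENNReal.ofReal ℓ) y := by
    intro y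
    by_cases hy : ‖WithLp.toLp 2 y‖ ≤ R
    · have hmem : y ∈ WithLp.toLp 2 ⁻¹' closedBall (0 : EuclideanSpace ℝ (Fin m)) R :=
        mem_closedBall_zero_iff.2 hy
      rw [Set.indicator_of_mem hmem]
      rw [lintegral_congr fun t => congrArg g (hline t y)]
      exact hℓ _
    · have hmem : y ∉ WithLp.toLp 2 ⁻¹' closedBall (0 : EuclideanSpace ℝ (Fin m)) R :=
        fun h => hy (mem_closedBall_zero_iff.1 h)
      rw [Set.indicator_of_notMem hmem]
      have h0 : ∀ t, g (Φ (t, y)) = 0 := fun t => hgR _ ((not_le.1 hy).trans_le (hnorm t y))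
      simp only [h0, lintegral_zero, le_refl]
  refine (lintegral_mono hsec).trans ?_
  have hmp := PiLp.volume_preserving_toLp (Fin m)
  rw [lintegral_indicator_const (hmp.measurable measurableSet_closedBall),
    hmp.measure_preimage measurableSet_closedBall.nullMeasurableSet,
    volume_closedBall_eq_unitBallVolume _ _ hR, mul_comm (ENNReal.ofReal ℓ), ← ENNReal.ofReal_mul
      (mul_nonneg (pow_nonneg hR _) (unitBallVolume_nonneg m)), mul_comm (R ^ m)]

theorem volume_le_of_forall_line {m : ℕ} {U : Set (EuclideanSpace ℝ (Fin (m + 1)))}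
    (hU : MeasurableSet U) (c : EuclideanSpace ℝ (Fin (m + 1))) {R : ℝ} (hR : 0 ≤ R)
    (hUR : U ⊆ closedBall c R) {u : EuclideanSpace ℝ (Fin (m + 1))} (hu : ‖u‖ = 1)
    {ℓ : ℝ} (hℓ : ∀ p, volume {t : ℝ | p + t • u ∈ U} ≤ ENNReal.ofReal ℓ) :
    volume U ≤ ENNReal.ofReal (unitBallVolume m * R ^ m * ℓ) := by
  rw [← lintegral_indicator_one hU]
  refine lintegral_le_of_forall_line (measurable_one.indicator hU) c hR (fun w hw => ?_) hu
    fun p => ?_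
  · refine Set.indicator_of_notMem (fun h => ?_) _
    have := hUR h
    rw [mem_closedBall_iff_norm] at this
    linarith
  · refine le_of_eq_of_le ?_ (hℓ p)
    have hm : MeasurableSet {t : ℝ | p + t • u ∈ U} :=
      (show Measurable fun t : ℝ => p + t • u by fun_prop) hU
    rw [← lintegral_indicator_one hm]
    rfl

theorem volume_setOf_mul_sq_le {a : ℝ} (ha : 0 < a) (t₀ h : ℝ) :
    volume {t : ℝ | a * (t - t₀) ^ 2 ≤ h} ≤ ENNReal.ofReal (2 * √h / √a) := by
  have hsub : {t : ℝ | a * (t - t₀) ^ 2 ≤ h} ⊆ Set.Icc (t₀ - √h / √a) (t₀ + √h / √a) := by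
    intro t ht
    have h1 : |t - t₀| ≤ √h / √a := by
      rw [le_div_iff₀ (Real.sqrt_pos.2 ha), mul_comm, ← Real.sqrt_sq_eq_abs,
        ← Real.sqrt_mul ha.le]
      exact Real.sqrt_le_sqrt ht
    rw [abs_le] at h1
    constructor <;> linarith
  refine (measure_mono hsub).trans ?_
  rw [Real.volume_Icc]
  exact ENNReal.ofReal_le_ofReal (le_of_eq (by ring))

theorem volume_setOf_le_mul_sq_le {a : ℝ} (ha : 0 < a) (t₀ s : ℝ) :
    volume {t : ℝ | s ≤ a * (t - t₀) ^ 2 ∧ a * (t - t₀) ^ 2 ≤ s + 2} ≤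
      ENNReal.ofReal (2 * (√(s + 2) - √s) / √a) := by
  have hsub : {t : ℝ | s ≤ a * (t - t₀) ^ 2 ∧ a * (t - t₀) ^ 2 ≤ s + 2} ⊆
      Set.Icc (t₀ - √(s + 2) / √a) (t₀ - √s / √a) ∪
        Set.Icc (t₀ + √s / √a) (t₀ + √(s + 2) / √a) := by
    rintro t ⟨ht, ht'⟩
    have h1 : |t - t₀| ≤ √(s + 2) / √a := by
      rw [le_div_iff₀ (Real.sqrt_pos.2 ha), mul_comm, ← Real.sqrt_sq_eq_abs,
        ← Real.sqrt_mul ha.le]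
      exact Real.sqrt_le_sqrt ht'
    have h2 : √s / √a ≤ |t - t₀| := by
      rw [div_le_iff₀ (Real.sqrt_pos.2 ha), mul_comm, ← Real.sqrt_sq_eq_abs,
        ← Real.sqrt_mul ha.le]
      exact Real.sqrt_le_sqrt ht
    rcases le_total 0 (t - t₀) with h | h
    · rw [abs_of_nonneg h] at h1 h2
      right
      constructor <;> linarith
    · rw [abs_of_nonpos h] at h1 h2
      left
      constructor <;> linarith
  have hle : √s / √a ≤ √(s + 2) / √a := by
    gcongr
    linarith
  refine (measure_mono hsub).trans ((measure_union_le _ _).trans ?_)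
  rw [Real.volume_Icc, Real.volume_Icc, ← ENNReal.ofReal_add (by linarith) (by linarith)]
  exact ENNReal.ofReal_le_ofReal (le_of_eq (by ring))

theorem sqrt_add_two_sub_sqrt_le (s : ℝ) : √(s + 2) - √s ≤ √2 := by
  rcases le_total 0 s with hs | hs
  · have := Real.sqrt_le_sqrt (show s + 2 ≤ (√s + √2) ^ 2 by
      nlinarith [Real.sq_sqrt hs, Real.sq_sqrt (show (0 : ℝ) ≤ 2 by norm_num),
        mul_nonneg (Real.sqrt_nonneg s) (Real.sqrt_nonneg 2)])
    rw [Real.sqrt_sq (by positivity)] at this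
    linarith
  · rw [Real.sqrt_eq_zero_of_nonpos hs, sub_zero]
    exact Real.sqrt_le_sqrt (by linarith)

/-- `f` is a real polynomial function of degree at most two. -/
def IsQuadraticFunction {E : Type*} [AddCommGroup E] [Module ℝ E] (f : E → ℝ) : Prop :=
  ∃ (k : ℝ) (l : E →ₗ[ℝ] ℝ) (B : E →ₗ[ℝ] E →ₗ[ℝ] ℝ), (∀ x y, B x y = B y x) ∧
    ∀ x, f x = k + l x + B x x

namespace IsQuadraticFunction

variable {E : Type*} [AddCommGroup E] [Module ℝ E]

theorem const (k : ℝ) : IsQuadraticFunction (fun _ : E => k) :=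
  ⟨k, 0, 0, by simp, by simp⟩

theorem linear (l : E →ₗ[ℝ] ℝ) : IsQuadraticFunction (fun x => l x) :=
  ⟨0, l, 0, by simp, by simp⟩

theorem mul_linear (l l' : E →ₗ[ℝ] ℝ) : IsQuadraticFunction (fun x => l x * l' x) := by
  refine ⟨0, 0, (1 / 2 : ℝ) • ((LinearMap.mul ℝ ℝ).compl₁₂ l l' +
    (LinearMap.mul ℝ ℝ).compl₁₂ l' l), fun x y => ?_, fun x => ?_⟩ <;> simp <;> ring

theorem add {f g : E → ℝ} (hf : IsQuadraticFunction f) (hg : IsQuadraticFunction g) :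
    IsQuadraticFunction (fun x => f x + g x) := by
  obtain ⟨k, l, B, hB, h⟩ := hf
  obtain ⟨k', l', B', hB', h'⟩ := hg
  refine ⟨k + k', l + l', B + B', fun x y => ?_, fun x => ?_⟩
  · simp [hB x y, hB' x y]
  · simp only [h, h', LinearMap.add_apply]
    ring

theorem const_mul {f : E → ℝ} (hf : IsQuadraticFunction f) (r : ℝ) :
    IsQuadraticFunction (fun x => r * f x) := by
  obtain ⟨k, l, B, hB, h⟩ := hf
  refine ⟨r * k, r • l, r • B, fun x y => ?_, fun x => ?_⟩
  · simp [hB x y]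
  · simp only [h, LinearMap.smul_apply, smul_eq_mul]
    ring

theorem sum {ι : Type*} (s : Finset ι) {f : ι → E → ℝ}
    (hf : ∀ i ∈ s, IsQuadraticFunction (f i)) :
    IsQuadraticFunction (fun x => ∑ i ∈ s, f i x) := by
  classical
  induction s using Finset.induction_on with
  | empty => simpa using const 0
  | insert i s hi ih =>
    simp only [Finset.sum_insert hi]
    exact (hf i (by simp)).add (ih fun j hj => hf j (by simp [hj]))

end IsQuadraticFunction

theorem Finsupp.exists_eq_single_add {σ : Type*} {d : σ →₀ ℕ} (hd : d ≠ 0) :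
    ∃ i d', d = Finsupp.single i 1 + d' := by
  obtain ⟨i, hi⟩ := Finsupp.ne_iff.1 hd
  refine ⟨i, d - Finsupp.single i 1, (add_tsub_cancel_of_le ?_).symm⟩
  rw [Finsupp.single_le_iff]
  exact Nat.one_le_iff_ne_zero.2 hi

theorem MvPolynomial.isQuadraticFunction_eval {n : ℕ} (P : MvPolynomial (Fin n) ℝ)
    (hP : P.totalDegree ≤ 2) :
    IsQuadraticFunction fun x : EuclideanSpace ℝ (Fin n) => MvPolynomial.eval (fun i => x i) P := by
  have hprod : ∀ (x : Fin n → ℝ) (i : Fin n) (d : Fin n →₀ ℕ),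
      (Finsupp.single i 1 + d).prod (fun j e => x j ^ e) = x i * d.prod fun j e => x j ^ e := by
    intro x i d
    rw [Finsupp.prod_add_index' (by simp) (by intros; rw [pow_add])]
    simp
  have hdeg : ∀ (i : Fin n) (d : Fin n →₀ ℕ),
      (Finsupp.single i 1 + d).degree = 1 + d.degree := by
    intro i d
    rw [map_add, Finsupp.degree_single]
  simp only [MvPolynomial.eval_eq]
  refine IsQuadraticFunction.sum _ fun d hd => IsQuadraticFunction.const_mul ?_ _
  have hd2 : d.degree ≤ 2 := (MvPolynomial.le_totalDegree hd).trans hP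
  change IsQuadraticFunction fun x : EuclideanSpace ℝ (Fin n) => d.prod fun j e => x j ^ e
  let l : Fin n → EuclideanSpace ℝ (Fin n) →ₗ[ℝ] ℝ := fun i =>
    (EuclideanSpace.proj i : EuclideanSpace ℝ (Fin n) →L[ℝ] ℝ).toLinearMap
  by_cases h0 : d = 0
  · subst h0
    simpa using IsQuadraticFunction.const 1
  obtain ⟨i, d, rfl⟩ := Finsupp.exists_eq_single_add h0
  simp only [hprod]
  by_cases h1 : d = 0
  · subst h1
    simpa [l] using IsQuadraticFunction.linear (l i)
  obtain ⟨j, d, rfl⟩ := Finsupp.exists_eq_single_add h1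
  simp only [hprod]
  have h2 : d = 0 := by
    rw [← Finsupp.degree_eq_zero_iff]
    rw [hdeg, hdeg] at hd2
    omega
  subst h2
  simpa [l] using IsQuadraticFunction.mul_linear (l i) (l j)

theorem IsPreconnected.exists_mem_frontier {X : Type*} [TopologicalSpace X] {S U : Set X}
    (hS : IsPreconnected S) (h : (S ∩ U).Nonempty) (h' : (S ∩ Uᶜ).Nonempty) :
    ∃ z ∈ S, z ∈ frontier U := by
  by_contra! hf
  obtain ⟨x, hxS, hx⟩ := h
  obtain ⟨y, hyS, hy⟩ := h'
  have hcover : ∀ z ∈ S, z ∈ interior U ∨ z ∈ (closure U)ᶜ := by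
    intro z hz
    by_contra! hc
    exact hf z hz ⟨not_not.1 hc.2, hc.1⟩
  have hx' : x ∈ interior U := (hcover x hxS).resolve_right fun h => h (subset_closure hx)
  have hy' : y ∈ (closure U)ᶜ := (hcover y hyS).resolve_left fun h => hy (interior_subset h)
  obtain ⟨z, _, hz, hz'⟩ := hS _ _ isOpen_interior isClosed_closure.isOpen_compl hcover
    ⟨x, hxS, hx'⟩ ⟨y, hyS, hy'⟩
  exact hz' (subset_closure (interior_subset hz))

/-- A ray starting in a bounded set leaves that set through its frontier. -/
theorem exists_mem_frontier_add_smul {E : Type*} [NormedAddCommGroup E] [NormedSpace ℝ E]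
    {U : Set E} (hU : Bornology.IsBounded U) {w v : E} (hw : w ∈ U) (hv : v ≠ 0) :
    ∃ t : ℝ, 0 ≤ t ∧ w + t • v ∈ frontier U := by
  obtain ⟨C, hC⟩ := hU.exists_norm_le
  have hv' : 0 < ‖v‖ := norm_pos_iff.2 hv
  set T : ℝ := (C + ‖w‖ + 1) / ‖v‖ with hT
  have hC0 : 0 ≤ C := (norm_nonneg w).trans (hC w hw)
  have hT0 : 0 ≤ T := by positivity
  have hout : w + T • v ∉ U := by
    intro h
    have h1 := hC _ h
    have h2 : ‖T • v‖ = C + ‖w‖ + 1 := by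
      rw [norm_smul, Real.norm_of_nonneg hT0, hT, div_mul_cancel₀ _ hv'.ne']
    have h3 : ‖T • v‖ ≤ ‖w + T • v‖ + ‖w‖ := by
      simpa [add_comm] using norm_sub_le (w + T • v) w
    linarith
  have hpre : IsPreconnected ((fun t : ℝ => w + t • v) '' Set.Icc 0 T) :=
    isPreconnected_Icc.image _ (by fun_prop)
  obtain ⟨z, ⟨t, ht, rfl⟩, hz⟩ := hpre.exists_mem_frontier (U := U)
    ⟨w, ⟨0, ⟨le_rfl, hT0⟩, by simp⟩, hw⟩ ⟨_, ⟨T, ⟨hT0, le_rfl⟩, rfl⟩, hout⟩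
  exact ⟨t, ht.1, hz⟩

theorem exists_mem_frontier_segment {E : Type*} [NormedAddCommGroup E] [NormedSpace ℝ E]
    {U : Set E} {w v : E} (hw : w ∈ U) (hv : w + v ∉ U) :
    ∃ t ∈ Set.Icc (0 : ℝ) 1, w + t • v ∈ frontier U := by
  have hpre : IsPreconnected ((fun t : ℝ => w + t • v) '' Set.Icc 0 1) :=
    isPreconnected_Icc.image _ (by fun_prop)
  obtain ⟨z, ⟨t, ht, rfl⟩, hz⟩ := hpre.exists_mem_frontier (U := U)
    ⟨w, ⟨0, by simp, by simp⟩, hw⟩ ⟨_, ⟨1, by simp, rfl⟩, by simpa [Set.mem_compl_iff] using hv⟩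
  exact ⟨t, ht, hz⟩

theorem toReal_le_of_le_ofReal {μ : ENNReal} {r : ℝ} (hr : 0 ≤ r) (h : μ ≤ ENNReal.ofReal r) :
    μ.toReal ≤ r :=
  (ENNReal.toReal_mono ENNReal.ofReal_ne_top h).trans (ENNReal.toReal_ofReal hr).le

/-- Completing the square along a line. -/
theorem quadratic_line {E : Type*} [AddCommGroup E] [Module ℝ E] {B : E →ₗ[ℝ] E →ₗ[ℝ] ℝ}
    (hB : ∀ x y, B x y = B y x) (p u : E) (ha : B u u ≠ 0) (t : ℝ) :
    B (p + t • u) (p + t • u) =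
      B u u * (t - -(B p u / B u u)) ^ 2 + (B p p - B p u ^ 2 / B u u) := by
  simp only [map_add, map_smul, LinearMap.add_apply, LinearMap.smul_apply, smul_eq_mul, hB u p]
  field_simp
  ring

theorem volume_le_of_curvature {m : ℕ} {U : Set (EuclideanSpace ℝ (Fin (m + 1)))}
    (hU : MeasurableSet U) (hUB : U ⊆ closedBall 0 1)
    {f : EuclideanSpace ℝ (Fin (m + 1)) → ℝ} {k : ℝ} {l : EuclideanSpace ℝ (Fin (m + 1)) →ₗ[ℝ] ℝ}
    {B : EuclideanSpace ℝ (Fin (m + 1)) →ₗ[ℝ] EuclideanSpace ℝ (Fin (m + 1)) →ₗ[ℝ] ℝ}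
    (hB : ∀ x y, B x y = B y x) (hf : ∀ x, f x = k + l x + B x x) (hfU : ∀ z ∈ U, |f z| ≤ 1)
    {u : EuclideanSpace ℝ (Fin (m + 1))} (hu : ‖u‖ = 1) (ha : B u u ≠ 0) :
    (volume U).toReal ≤ unitBallVolume m * (2 * √2 / √|B u u|) := by
  wlog hpos : 0 < B u u generalizing f k l B
  · have h := this (f := fun x => -f x) (k := -k) (l := -l) (B := -B) (fun x y => by simp [hB x y])
      (fun x => by simp only [hf, LinearMap.neg_apply]; ring) (fun z hz => by
        rw [abs_neg]; exact hfU z hz) (by simpa using ha)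
      (by simpa using lt_of_le_of_ne (not_lt.1 hpos) ha)
    simpa using h
  rw [abs_of_pos hpos]
  refine toReal_le_of_le_ofReal (mul_nonneg (unitBallVolume_nonneg m) (by positivity)) ?_
  have key := volume_le_of_forall_line hU 0 zero_le_one hUB hu (ℓ := 2 * √2 / √(B u u)) ?_
  · simpa using key
  intro p
  set q : ℝ := k + l p - (2 * B p u + l u) ^ 2 / (4 * B u u) + B p p with hq
  have hline : ∀ t : ℝ, f (p + t • u) =
      B u u * (t - -((2 * B p u + l u) / (2 * B u u))) ^ 2 + q := by
    intro t
    rw [hf, hq]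
    simp only [map_add, map_smul, LinearMap.add_apply, LinearMap.smul_apply, smul_eq_mul, hB u p]
    field_simp
    ring
  refine (measure_mono fun t ht => ?_).trans ((volume_setOf_le_mul_sq_le hpos
    (-((2 * B p u + l u) / (2 * B u u))) (-1 - q)).trans (ENNReal.ofReal_le_ofReal ?_))
  · have := abs_le.1 (hfU _ ht)
    rw [hline] at this
    constructor <;> linarith
  · gcongr
    exact sqrt_add_two_sub_sqrt_le _

theorem volume_le_of_slope {m : ℕ} {U : Set (EuclideanSpace ℝ (Fin (m + 1)))}
    (hU : MeasurableSet U) (hUB : U ⊆ closedBall 0 1)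
    {f : EuclideanSpace ℝ (Fin (m + 1)) → ℝ} {k : ℝ} {l : EuclideanSpace ℝ (Fin (m + 1)) →ₗ[ℝ] ℝ}
    {B : EuclideanSpace ℝ (Fin (m + 1)) →ₗ[ℝ] EuclideanSpace ℝ (Fin (m + 1)) →ₗ[ℝ] ℝ}
    (hB : ∀ x y, B x y = B y x) (hf : ∀ x, f x = k + l x + B x x) (hfU : ∀ z ∈ U, |f z| ≤ 1)
    {u : EuclideanSpace ℝ (Fin (m + 1))} (hu : ‖u‖ = 1) {δ : ℝ} (hδ : 0 < δ)
    (hslope : ∀ w ∈ closedBall (0 : EuclideanSpace ℝ (Fin (m + 1))) 1, δ ≤ |l u + 2 * B w u|) :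
    (volume U).toReal ≤ unitBallVolume m * (2 / δ) := by
  refine toReal_le_of_le_ofReal (mul_nonneg (unitBallVolume_nonneg m) (by positivity)) ?_
  have key := volume_le_of_forall_line hU 0 zero_le_one hUB hu (ℓ := 2 / δ) ?_
  · simpa using key
  intro p
  refine (Real.volume_le_diam _).trans (Metric.ediam_le_of_forall_dist_le fun s hs t ht => ?_)
  have hmid : p + ((s + t) / 2) • u ∈ closedBall (0 : EuclideanSpace ℝ (Fin (m + 1))) 1 := by
    have h := convex_closedBall (0 : EuclideanSpace ℝ (Fin (m + 1))) 1 (hUB hs) (hUB ht)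
      (show (0 : ℝ) ≤ 1 / 2 by norm_num) (show (0 : ℝ) ≤ 1 / 2 by norm_num) (by norm_num)
    convert h using 1
    module
  have hdiff : f (p + s • u) - f (p + t • u) =
      (s - t) * (l u + 2 * B (p + ((s + t) / 2) • u) u) := by
    rw [hf, hf]
    simp only [map_add, map_smul, LinearMap.add_apply, LinearMap.smul_apply, smul_eq_mul, hB u p]
    ring
  have h1 := abs_le.1 (hfU _ hs)
  have h2 := abs_le.1 (hfU _ ht)
  have h3 : |s - t| * |l u + 2 * B (p + ((s + t) / 2) • u) u| ≤ 2 := by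
    rw [← abs_mul, ← hdiff, abs_le]
    constructor <;> linarith
  rw [Real.dist_eq, le_div_iff₀ hδ]
  exact (mul_le_mul_of_nonneg_left (hslope _ hmid) (abs_nonneg _)).trans h3

theorem abs_bilin_le {E : Type*} [NormedAddCommGroup E] [InnerProductSpace ℝ E]
    {B : E →ₗ[ℝ] E →ₗ[ℝ] ℝ} (hB : ∀ x y, B x y = B y x) {A : ℝ}
    (hA : ∀ u, ‖u‖ = 1 → |B u u| ≤ A) (x y : E) : |B x y| ≤ A * ‖x‖ * ‖y‖ := by
  have hsq : ∀ z, |B z z| ≤ A * ‖z‖ ^ 2 := by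
    intro z
    rcases eq_or_ne z 0 with rfl | hz
    · simp
    have hz' : ‖z‖ ≠ 0 := norm_ne_zero_iff.2 hz
    have h := hA (‖z‖⁻¹ • z) (norm_smul_inv_norm hz)
    simp only [map_smul, LinearMap.smul_apply, smul_eq_mul, abs_mul, abs_inv, abs_norm] at h
    rw [← mul_assoc, ← mul_inv, inv_mul_le_iff₀ (by positivity)] at h
    linarith
  have hunit : ∀ z w, ‖z‖ = 1 → ‖w‖ = 1 → |B z w| ≤ A := by
    intro z w hz hw
    have h1 := abs_le.1 (hsq (z + w))
    have h2 := abs_le.1 (hsq (z - w))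
    have h3 := parallelogram_law_with_norm ℝ z w
    have h4 : 4 * B z w = B (z + w) (z + w) - B (z - w) (z - w) := by
      simp only [map_add, map_sub, LinearMap.add_apply, LinearMap.sub_apply, hB w z]
      ring
    rw [hz, hw] at h3
    rw [abs_le]
    constructor <;> nlinarith
  rcases eq_or_ne x 0 with rfl | hx
  · simp
  rcases eq_or_ne y 0 with rfl | hy
  · simp
  have hx' : 0 < ‖x‖ := norm_pos_iff.2 hx
  have hy' : 0 < ‖y‖ := norm_pos_iff.2 hy
  have h := hunit (‖x‖⁻¹ • x) (‖y‖⁻¹ • y) (norm_smul_inv_norm hx) (norm_smul_inv_norm hy)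
  simp only [map_smul, LinearMap.smul_apply, smul_eq_mul, abs_mul, abs_inv, abs_norm] at h
  rw [← mul_assoc, ← mul_inv, inv_mul_le_iff₀ (by positivity)] at h
  linarith

theorem exists_abs_bilin_max {m : ℕ}
    (B : EuclideanSpace ℝ (Fin (m + 1)) →ₗ[ℝ] EuclideanSpace ℝ (Fin (m + 1)) →ₗ[ℝ] ℝ) :
    ∃ e, ‖e‖ = 1 ∧ ∀ u, ‖u‖ = 1 → |B u u| ≤ |B e e| := by
  have hc : Continuous fun u => |B u u| := by
    have h : Continuous fun z : EuclideanSpace ℝ (Fin (m + 1)) × EuclideanSpace ℝ (Fin (m + 1)) =>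
        B z.1 z.2 := by
      have h1 : Continuous fun x => (LinearMap.toContinuousLinearMap (B x)) :=
        (LinearMap.toContinuousLinearMap.toLinearMap ∘ₗ B).continuous_of_finiteDimensional
      exact (h1.comp continuous_fst).clm_apply continuous_snd
    exact (h.comp (continuous_id.prodMk continuous_id)).abs
  obtain ⟨e, he, hmax⟩ := (isCompact_sphere (0 : EuclideanSpace ℝ (Fin (m + 1))) 1).exists_isMaxOn
    (NormedSpace.sphere_nonempty.2 zero_le_one) hc.continuousOn
  exact ⟨e, by simpa using he, fun u hu => hmax (by simpa using hu)⟩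

/-- A numerical criterion for the Remez-type inequality for quadratic functions. -/
theorem remez_quadratic_aux {m : ℕ} {U : Set (EuclideanSpace ℝ (Fin (m + 1)))}
    (hU : MeasurableSet U) (hUB : U ⊆ closedBall 0 1)
    {f : EuclideanSpace ℝ (Fin (m + 1)) → ℝ} (hf : IsQuadraticFunction f)
    (hfU : ∀ z ∈ U, |f z| ≤ 1) {x y : EuclideanSpace ℝ (Fin (m + 1))} (hx : x ∈ closedBall 0 1)
    (hy : y ∈ U) {κ : ℝ} (hκ : 0 < κ) (hκm : unitBallVolume m ≤ κ * (m + 1)) (hM : 1 < |f x|)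
    (hnum : κ * √|f x| / 4 ≤ (|f x| - 1) / 2 - 3 * (κ ^ 2 / 8 * |f x|)) :
    |f x| * (volume U).toReal ^ 2 ≤ 64 * (m + 1) ^ 2 := by
  obtain ⟨k, l, B, hB, hf⟩ := hf
  obtain ⟨e, he, hmax⟩ := exists_abs_bilin_max B
  set M := |f x|
  set v := (volume U).toReal
  have hM0 : 0 < M := by linarith
  have hv0 : 0 ≤ v := ENNReal.toReal_nonneg
  have hω := unitBallVolume_nonneg m
  rcases le_or_gt (κ ^ 2 / 8 * M) |B e e| with hA | hA
  · have hA0 : 0 < |B e e| := lt_of_lt_of_le (by positivity) hA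
    have h1 : v ≤ unitBallVolume m * (2 * √2 / √|B e e|) :=
      volume_le_of_curvature hU hUB hB hf hfU he (abs_pos.1 hA0)
    have h2 : v * √|B e e| ≤ κ * (m + 1) * (2 * √2) := by
      rw [← mul_div_assoc, le_div_iff₀ (Real.sqrt_pos.2 hA0)] at h1
      exact h1.trans (by gcongr)
    have h3 := pow_le_pow_left₀ (by positivity) h2 2
    rw [mul_pow, Real.sq_sqrt hA0.le, mul_pow, mul_pow 2, Real.sq_sqrt zero_le_two] at h3
    have h4 : v ^ 2 * (κ ^ 2 / 8 * M) ≤ v ^ 2 * |B e e| := by gcongr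
    have h5 : κ ^ 2 * (M * v ^ 2) ≤ κ ^ 2 * (64 * (m + 1) ^ 2) := by nlinarith
    exact le_of_mul_le_mul_left h5 (by positivity)
  · have hbil := abs_bilin_le hB hmax
    rw [mem_closedBall_zero_iff] at hx
    have hy1 := mem_closedBall_zero_iff.1 (hUB hy)
    have hfy := hfU y hy
    have hxy : x ≠ y := by
      rintro rfl
      linarith
    have hd : 0 < ‖x - y‖ := norm_pos_iff.2 (sub_ne_zero.2 hxy)
    have hd2 : ‖x - y‖ ≤ 2 := (norm_sub_le _ _).trans (by linarith)
    set A := |B e e|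
    have hA0 : 0 ≤ A := abs_nonneg _
    have hδ : 0 < (M - 1) / 2 - 3 * A := by
      have : 0 < κ * √M / 4 := by positivity
      linarith
    have hlin : (M - 1) / 2 - A ≤ |l (‖x - y‖⁻¹ • (x - y))| := by
      have h1 : f x - f y = l (x - y) + B (x + y) (x - y) := by
        rw [hf, hf]
        simp only [map_add, map_sub, LinearMap.add_apply, hB y x]
        ring
      have h2 : M - 1 ≤ |f x - f y| := by
        have := abs_sub_abs_le_abs_sub (f x) (f y)
        linarith
      have h3 : |B (x + y) (x - y)| ≤ A * 2 := by
        refine (hbil _ _).trans ?_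
        rw [mul_assoc]
        gcongr
        have := parallelogram_law_with_norm ℝ x y
        nlinarith [sq_nonneg (‖x + y‖ - ‖x - y‖), norm_nonneg x, norm_nonneg y]
      have h4 : M - 1 - 2 * A ≤ |l (x - y)| := by
        rw [h1] at h2
        have := abs_add_le (l (x - y)) (B (x + y) (x - y))
        linarith
      rw [map_smul, smul_eq_mul, abs_mul, abs_inv, abs_norm, le_inv_mul_iff₀ hd]
      have : ‖x - y‖ * ((M - 1) / 2 - A) ≤ 2 * ((M - 1) / 2 - A) := by
        gcongr
        linarith
      linarith
    have h1 : v ≤ unitBallVolume m * (2 / ((M - 1) / 2 - 3 * A)) := by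
      refine volume_le_of_slope hU hUB hB hf hfU (u := ‖x - y‖⁻¹ • (x - y))
        (norm_smul_inv_norm (sub_ne_zero.2 hxy)) hδ fun w hw => ?_
      rw [mem_closedBall_zero_iff] at hw
      have h2 : |B w (‖x - y‖⁻¹ • (x - y))| ≤ A := by
        refine (hbil _ _).trans ?_
        have h3 : ‖‖x - y‖⁻¹ • (x - y)‖ = 1 := norm_smul_inv_norm (sub_ne_zero.2 hxy)
        rw [h3, mul_one]
        exact mul_le_of_le_one_right hA0 hw
      have h3 := abs_sub_abs_le_abs_sub (l (‖x - y‖⁻¹ • (x - y)))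
        (-(2 * B w (‖x - y‖⁻¹ • (x - y))))
      rw [abs_neg, abs_mul, abs_two, sub_neg_eq_add] at h3
      linarith
    have h2 : v * (κ * √M / 4) ≤ κ * (m + 1) * 2 := by
      rw [← mul_div_assoc, le_div_iff₀ hδ] at h1
      calc v * (κ * √M / 4) ≤ v * ((M - 1) / 2 - 3 * A) := by
            gcongr
            linarith
        _ ≤ _ := h1.trans (by gcongr)
    have h3 : κ * (v * √M) ≤ κ * (8 * (m + 1)) := by linarith
    have h4 := pow_le_pow_left₀ (by positivity) (le_of_mul_le_mul_left h3 hκ) 2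
    rw [mul_pow, Real.sq_sqrt hM0.le] at h4
    linarith

theorem volume_toReal_le_unitBallVolume {n : ℕ} {U : Set (EuclideanSpace ℝ (Fin n))}
    (hUB : U ⊆ closedBall 0 1) : (volume U).toReal ≤ unitBallVolume n := by
  refine toReal_le_of_le_ofReal (unitBallVolume_nonneg n) ((measure_mono hUB).trans ?_)
  rw [volume_closedBall_eq_unitBallVolume n 0 zero_le_one, one_pow, one_mul]

/-- A Remez-type inequality for quadratic functions on the unit ball. -/
theorem remez_quadratic {m : ℕ} {U : Set (EuclideanSpace ℝ (Fin (m + 1)))}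
    (hU : MeasurableSet U) (hUB : U ⊆ closedBall 0 1)
    {f : EuclideanSpace ℝ (Fin (m + 1)) → ℝ} (hf : IsQuadraticFunction f)
    (hfU : ∀ z ∈ U, |f z| ≤ 1) {x y : EuclideanSpace ℝ (Fin (m + 1))} (hx : x ∈ closedBall 0 1)
    (hy : y ∈ U) : |f x| * (volume U).toReal ^ 2 ≤ 64 * (m + 1) ^ 2 := by
  by_contra! hcon
  set M := |f x|
  set v := (volume U).toReal
  have hv0 : 0 ≤ v := ENNReal.toReal_nonneg
  have hM0 : 0 ≤ M := abs_nonneg _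
  have hvω : v ≤ unitBallVolume (m + 1) := volume_toReal_le_unitBallVolume hUB
  have hr := Real.sq_sqrt hM0
  rcases Nat.eq_zero_or_pos m with rfl | hm
  · rw [zero_add, unitBallVolume_one] at hvω
    have hM : 16 < M := by
      have : M * v ^ 2 ≤ M * 2 ^ 2 := by gcongr
      norm_num at hcon
      linarith
    have h4 : 4 ≤ √M := Real.le_sqrt_of_sq_le (by linarith)
    refine hcon.not_ge (remez_quadratic_aux hU hUB hf hfU hx hy (κ := 1) one_pos ?_ ?_ ?_)
    · rw [unitBallVolume_zero]; norm_num
    · linarith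
    · change 1 * √M / 4 ≤ (M - 1) / 2 - 3 * (1 ^ 2 / 8 * M)
      nlinarith
  · have hm' : (1 : ℝ) ≤ m := by exact_mod_cast hm
    have hpi := Real.pi_lt_d2
    have hpi0 := Real.pi_pos
    have hω : v ≤ 1.575 * (m + 1) := by
      have := unitBallVolume_le (m + 1)
      push_cast at this
      nlinarith
    have hM : 25.7 < M := by
      have h1 : M * v ^ 2 ≤ M * (1.575 * (m + 1)) ^ 2 := by gcongr
      have h2 : 64 * ((m : ℝ) + 1) ^ 2 < (M * 1.575 ^ 2) * (m + 1) ^ 2 := by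
        rw [mul_pow, ← mul_assoc] at h1
        linarith
      have := lt_of_mul_lt_mul_right h2 (by positivity)
      norm_num at this
      linarith
    have h4 : 5 ≤ √M := Real.le_sqrt_of_sq_le (by linarith)
    refine hcon.not_ge (remez_quadratic_aux hU hUB hf hfU hx hy (κ := 1.05) (by norm_num) ?_ ?_ ?_)
    · refine (unitBallVolume_le m).trans ?_
      gcongr
      linarith
    · linarith
    · change 1.05 * √M / 4 ≤ (M - 1) / 2 - 3 * (1.05 ^ 2 / 8 * M)
      nlinarith

theorem sqrt_combination_le {θ C σ s : ℝ} (hθ : 0 ≤ θ) (hθ' : θ ≤ 1) (hC : 0 ≤ C)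
    (hCθ : 2 * (1 + θ) ^ 2 ≤ C ^ 2) (hσ : 0 ≤ σ) (hσC : (1 - θ) * (1 + 3 * θ) * σ ≤ 4 * θ * C)
    (hs : s ≤ σ ^ 2) : (1 + θ) * √(s + 2) - 2 * θ * √s ≤ C := by
  suffices (1 + θ) * √(s + 2) ≤ C + 2 * θ * √s by linarith
  have hr := Real.sqrt_nonneg s
  refine (sq_le_sq₀ (by positivity) (by positivity)).1 ?_
  rcases le_total s 0 with h0 | h0
  · rw [Real.sqrt_eq_zero_of_nonpos h0]
    have h1 : √(s + 2) ^ 2 ≤ 2 := by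
      have : √(s + 2) ≤ √2 := Real.sqrt_le_sqrt (by linarith)
      calc √(s + 2) ^ 2 ≤ √2 ^ 2 := by gcongr
        _ = 2 := Real.sq_sqrt zero_le_two
    rw [mul_pow]
    nlinarith [sq_nonneg (1 + θ)]
  · have h1 : √s ≤ σ := (Real.sqrt_le_sqrt hs).trans_eq (Real.sqrt_sq hσ)
    have h2 : √s ^ 2 = s := Real.sq_sqrt h0
    rw [mul_pow, Real.sq_sqrt (by linarith)]
    have h3 : (1 - θ) * (1 + 3 * θ) * √s ≤ 4 * θ * C :=
      le_trans (mul_le_mul_of_nonneg_left h1 (mul_nonneg (by linarith) (by linarith))) hσC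
    have h4 := mul_le_mul_of_nonneg_right h3 hr
    nlinarith

/-- A concave quadratic function `c + v ↦ K - B v v` with maximum `K > 1` whose superlevel set
`{f > 1}` is contained in the unit ball. -/
structure IsCap {m : ℕ} (f : EuclideanSpace ℝ (Fin (m + 1)) → ℝ) (K : ℝ)
    (c : EuclideanSpace ℝ (Fin (m + 1)))
    (B : EuclideanSpace ℝ (Fin (m + 1)) →ₗ[ℝ] EuclideanSpace ℝ (Fin (m + 1)) →ₗ[ℝ] ℝ) :
    Prop where
  one_lt : 1 < K
  symm : ∀ x y, B x y = B y x
  eq_sub : ∀ v, f (c + v) = K - B v v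
  pos : ∀ v, v ≠ 0 → 0 < B v v
  mem_ball : ∀ v, B v v < K - 1 → c + v ∈ closedBall 0 1

namespace IsCap

variable {m : ℕ} {f : EuclideanSpace ℝ (Fin (m + 1)) → ℝ} {K : ℝ}
  {c : EuclideanSpace ℝ (Fin (m + 1))}
  {B : EuclideanSpace ℝ (Fin (m + 1)) →ₗ[ℝ] EuclideanSpace ℝ (Fin (m + 1)) →ₗ[ℝ] ℝ}

theorem line_eq (h : IsCap f K c B) {u : EuclideanSpace ℝ (Fin (m + 1))} (hu : ‖u‖ = 1)
    (p : EuclideanSpace ℝ (Fin (m + 1))) (t : ℝ) :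
    f (p + t • u) = K - (B u u * (t - -(B (p - c) u / B u u)) ^ 2 +
      (B (p - c) (p - c) - B (p - c) u ^ 2 / B u u)) := by
  have hu0 : u ≠ 0 := by
    rintro rfl
    simp at hu
  rw [← quadratic_line h.symm _ _ (h.pos u hu0).ne', ← h.eq_sub]
  congr 1
  abel

theorem schur_nonneg (h : IsCap f K c B) {u : EuclideanSpace ℝ (Fin (m + 1))} (hu : ‖u‖ = 1)
    (p : EuclideanSpace ℝ (Fin (m + 1))) : 0 ≤ B p p - B p u ^ 2 / B u u := by
  have hu0 : u ≠ 0 := by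
    rintro rfl
    simp at hu
  have hq := quadratic_line h.symm p u (h.pos u hu0).ne' (-(B p u / B u u))
  rw [sub_self, zero_pow two_ne_zero, mul_zero, zero_add] at hq
  rw [← hq]
  rcases eq_or_ne (p + -(B p u / B u u) • u) 0 with h0 | h0
  · rw [h0]
    simp
  · exact (h.pos _ h0).le

theorem norm_sq_add_le (h : IsCap f K c B) {v : EuclideanSpace ℝ (Fin (m + 1))}
    (hv : B v v ≤ K - 1) : ‖c‖ ^ 2 + ‖v‖ ^ 2 ≤ 1 := by
  have hK := h.one_lt
  have hlt : ∀ w, B w w < K - 1 → ‖c‖ ^ 2 + ‖w‖ ^ 2 ≤ 1 := by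
    intro w hw
    have h1 := h.mem_ball w hw
    have h2 := h.mem_ball (-w) (by simpa using hw)
    rw [mem_closedBall_zero_iff] at h1 h2
    rw [← sub_eq_add_neg] at h2
    have h3 := parallelogram_law_with_norm ℝ c w
    nlinarith [norm_nonneg (c + w), norm_nonneg (c - w)]
  have hc : ‖c‖ ^ 2 ≤ 1 := by simpa using hlt 0 (by simpa using hK)
  by_contra! hcon
  have hv0 : 0 < ‖v‖ := by
    rw [norm_pos_iff]
    rintro rfl
    simp at hcon
    nlinarith [norm_nonneg c]
  obtain ⟨r, hr1, hr2⟩ := exists_between (show 1 - ‖c‖ ^ 2 < ‖v‖ ^ 2 by linarith)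
  have hr0 : 0 < r := by linarith
  have hr3 : r / ‖v‖ ^ 2 < 1 := (div_lt_one (by positivity)).2 hr2
  have hs : √(r / ‖v‖ ^ 2) ^ 2 = r / ‖v‖ ^ 2 := Real.sq_sqrt (by positivity)
  have h1 := hlt (√(r / ‖v‖ ^ 2) • v) (by
    simp only [map_smul, LinearMap.smul_apply, smul_eq_mul]
    rw [← mul_assoc, ← sq, hs]
    have := h.pos v (norm_pos_iff.1 hv0)
    nlinarith)
  rw [norm_smul, mul_pow, Real.norm_eq_abs, sq_abs, hs, div_mul_cancel₀ _ (by positivity)] at h1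
  linarith

theorem norm_sq_le (h : IsCap f K c B) {v : EuclideanSpace ℝ (Fin (m + 1))}
    (hv : B v v ≤ K + 1) {R : ℝ} (hR : (K + 1) * (1 - ‖c‖ ^ 2) ≤ R ^ 2 * (K - 1)) :
    ‖v‖ ^ 2 ≤ R ^ 2 := by
  have hK := h.one_lt
  have hK1 : 0 < K - 1 := by linarith
  have hs : √((K - 1) / (K + 1)) ^ 2 = (K - 1) / (K + 1) := Real.sq_sqrt (by positivity)
  have h1 := h.norm_sq_add_le (v := √((K - 1) / (K + 1)) • v) (by
    simp only [map_smul, LinearMap.smul_apply, smul_eq_mul]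
    rw [← mul_assoc, ← sq, hs, div_mul_eq_mul_div, div_le_iff₀ (by linarith)]
    gcongr)
  rw [norm_smul, mul_pow, Real.norm_eq_abs, sq_abs, hs] at h1
  have h2 : (K - 1) / (K + 1) * ‖v‖ ^ 2 ≤ 1 - ‖c‖ ^ 2 := by linarith
  rw [div_mul_eq_mul_div, div_le_iff₀ (by linarith)] at h2
  nlinarith

theorem sub_one_le (h : IsCap f K c B) {u : EuclideanSpace ℝ (Fin (m + 1))} (hu : ‖u‖ = 1) :
    K - 1 ≤ B u u := by
  have hK := h.one_lt
  have ha : 0 < B u u := h.pos u (by rintro rfl; simp at hu)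
  have hs : √((K - 1) / B u u) ^ 2 = (K - 1) / B u u :=
    Real.sq_sqrt (div_nonneg (by linarith) ha.le)
  have h1 := h.norm_sq_add_le (v := √((K - 1) / B u u) • u) (by
    simp only [map_smul, LinearMap.smul_apply, smul_eq_mul]
    rw [← mul_assoc, ← sq, hs, div_mul_cancel₀ _ ha.ne'])
  rw [norm_smul, mul_pow, Real.norm_eq_abs, sq_abs, hs, hu, one_pow, mul_one] at h1
  have h2 : (K - 1) / B u u ≤ 1 := by nlinarith [sq_nonneg ‖c‖]
  exact (div_le_one ha).1 h2

variable {W U' : Set (EuclideanSpace ℝ (Fin (m + 1)))} {μ : ℝ}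

theorem mul_sqrt_le_of_weight (h : IsCap f K c B) (hW : MeasurableSet W) (hU' : MeasurableSet U')
    (hWB : W ⊆ closedBall 0 1) (hU'W : U' ⊆ W) (hfW : ∀ z ∈ W, -1 ≤ f z) (hfU' : ∀ z ∈ U', f z ≤ 1)
    (hμ : 0 ≤ μ) (hμW : ENNReal.ofReal (2 * μ) ≤ volume W) (hμU' : ENNReal.ofReal μ ≤ volume U')
    {u : EuclideanSpace ℝ (Fin (m + 1))} (hu : ‖u‖ = 1) {θ C : ℝ} (hθ : 0 ≤ θ) (hθ' : θ ≤ 1)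
    (hC : 0 ≤ C) (hθC : ∀ p, (1 + θ) * √(K - 1 - (B p p - B p u ^ 2 / B u u) + 2) -
      2 * θ * √(K - 1 - (B p p - B p u ^ 2 / B u u)) ≤ C) :
    μ * √(B u u) ≤ unitBallVolume m * C := by
  have ha : 0 < B u u := h.pos u (by rintro rfl; simp at hu)
  have hα : 0 ≤ (1 - θ) / 2 := by linarith
  set g : EuclideanSpace ℝ (Fin (m + 1)) → ENNReal := fun w =>
    W.indicator (fun _ => ENNReal.ofReal ((1 - θ) / 2)) w +
      U'.indicator (fun _ => ENNReal.ofReal θ) w with hg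
  have hWm : Measurable (W.indicator fun _ => ENNReal.ofReal ((1 - θ) / 2)) :=
    measurable_const.indicator hW
  have hgm : Measurable g := hWm.add (measurable_const.indicator hU')
  have hlow : ENNReal.ofReal μ ≤ ∫⁻ w, g w := by
    rw [hg, lintegral_add_left hWm, lintegral_indicator_const hW, lintegral_indicator_const hU']
    calc ENNReal.ofReal μ = ENNReal.ofReal ((1 - θ) / 2) * ENNReal.ofReal (2 * μ) +
          ENNReal.ofReal θ * ENNReal.ofReal μ := by
          rw [← ENNReal.ofReal_mul hα, ← ENNReal.ofReal_mul hθ,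
            ← ENNReal.ofReal_add (by positivity) (by positivity)]
          congr 1
          ring
      _ ≤ _ := by gcongr
  have hup : ∫⁻ w, g w ≤ ENNReal.ofReal (unitBallVolume m * 1 ^ m * (C / √(B u u))) := by
    refine lintegral_le_of_forall_line hgm 0 zero_le_one (fun w hw => ?_) hu fun p => ?_
    · have hwW : w ∉ W := fun hw' => by
        have := mem_closedBall_zero_iff.1 (hWB hw')
        rw [sub_zero] at hw
        linarith
      have hwU : w ∉ U' := fun hw' => hwW (hU'W hw')
      simp [hg, hwW, hwU]
    · have hline : Measurable fun t : ℝ => p + t • u := by fun_prop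
      have hWl : MeasurableSet {t : ℝ | p + t • u ∈ W} := hline hW
      have hUl : MeasurableSet {t : ℝ | p + t • u ∈ U'} := hline hU'
      have hgl : ∀ t : ℝ, g (p + t • u) =
          {t : ℝ | p + t • u ∈ W}.indicator (fun _ => ENNReal.ofReal ((1 - θ) / 2)) t +
          {t : ℝ | p + t • u ∈ U'}.indicator (fun _ => ENNReal.ofReal θ) t := fun t => rfl
      rw [lintegral_congr hgl, lintegral_add_left (measurable_const.indicator hWl),
        lintegral_indicator_const hWl, lintegral_indicator_const hUl]
      set s := K - 1 - (B (p - c) (p - c) - B (p - c) u ^ 2 / B u u) with hs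
      have h1 : volume {t : ℝ | p + t • u ∈ W} ≤ ENNReal.ofReal (2 * √(s + 2) / √(B u u)) := by
        refine (measure_mono fun t ht => ?_).trans
          (volume_setOf_mul_sq_le ha (-(B (p - c) u / B u u)) (s + 2))
        have := hfW _ ht
        rw [h.line_eq hu] at this
        rw [Set.mem_ofPred_eq]
        linarith
      have h2 : volume {t : ℝ | p + t • u ∈ U'} ≤
          ENNReal.ofReal (2 * (√(s + 2) - √s) / √(B u u)) := by
        refine (measure_mono fun t ht => ?_).trans
          (volume_setOf_le_mul_sq_le ha (-(B (p - c) u / B u u)) s)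
        have h3 := hfW _ (hU'W ht)
        have h4 := hfU' _ ht
        rw [h.line_eq hu] at h3 h4
        constructor <;> linarith
      have hs2 : √s ≤ √(s + 2) := Real.sqrt_le_sqrt (by linarith)
      calc _ ≤ ENNReal.ofReal ((1 - θ) / 2) * ENNReal.ofReal (2 * √(s + 2) / √(B u u)) +
            ENNReal.ofReal θ * ENNReal.ofReal (2 * (√(s + 2) - √s) / √(B u u)) := by gcongr
        _ = ENNReal.ofReal (((1 + θ) * √(s + 2) - 2 * θ * √s) / √(B u u)) := by
          rw [← ENNReal.ofReal_mul hα, ← ENNReal.ofReal_mul hθ,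
            ← ENNReal.ofReal_add (by positivity)
              (mul_nonneg hθ (div_nonneg (by linarith) (Real.sqrt_nonneg _)))]
          congr 1
          ring
        _ ≤ _ := by
          gcongr
          exact hθC (p - c)
  have hω := unitBallVolume_nonneg m
  have h5 := (ENNReal.ofReal_le_ofReal_iff (by positivity)).1 (hlow.trans hup)
  rwa [one_pow, mul_one, ← mul_div_assoc, le_div_iff₀ (Real.sqrt_pos.2 ha)] at h5

theorem mul_sqrt_le_of_radius (h : IsCap f K c B) (hU' : MeasurableSet U')
    (hfU' : ∀ z ∈ U', |f z| ≤ 1) (hμU' : ENNReal.ofReal μ ≤ volume U')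
    {u : EuclideanSpace ℝ (Fin (m + 1))} (hu : ‖u‖ = 1) {R : ℝ} (hR0 : 0 ≤ R)
    (hR : (K + 1) * (1 - ‖c‖ ^ 2) ≤ R ^ 2 * (K - 1)) :
    μ * √(B u u) ≤ unitBallVolume m * R ^ m * (2 * √2) := by
  have ha : 0 < B u u := h.pos u (by rintro rfl; simp at hu)
  have hω := unitBallVolume_nonneg m
  have key := volume_le_of_forall_line hU' c hR0 (fun w hw => ?_) hu (ℓ := 2 * √2 / √(B u u))
    fun p => ?_
  · have h5 := (ENNReal.ofReal_le_ofReal_iff (by positivity)).1 (hμU'.trans key)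
    rwa [← mul_div_assoc, le_div_iff₀ (Real.sqrt_pos.2 ha)] at h5
  · rw [mem_closedBall_iff_norm]
    have h1 := (abs_le.1 (hfU' w hw)).1
    have h2 := h.eq_sub (w - c)
    rw [add_sub_cancel] at h2
    exact (sq_le_sq₀ (norm_nonneg _) hR0).1 (h.norm_sq_le (by linarith) hR)
  · refine (measure_mono fun t ht => ?_).trans ((volume_setOf_le_mul_sq_le ha
      (-(B (p - c) u / B u u)) (K - 1 - (B (p - c) (p - c) - B (p - c) u ^ 2 / B u u))).trans
        (ENNReal.ofReal_le_ofReal ?_))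
    · have h3 := abs_le.1 (hfU' _ ht)
      rw [h.line_eq hu] at h3
      constructor <;> linarith
    · gcongr
      exact sqrt_add_two_sub_sqrt_le _

end IsCap

theorem unitBallVolume_le_mul (m : ℕ) : unitBallVolume m ≤ 1.0472 * (m + 1) := by
  refine (unitBallVolume_le m).trans ?_
  have := Real.pi_lt_d4
  gcongr
  linarith

namespace IsCap

variable {m : ℕ} {f : EuclideanSpace ℝ (Fin (m + 1)) → ℝ} {K : ℝ}
  {c : EuclideanSpace ℝ (Fin (m + 1))}
  {B : EuclideanSpace ℝ (Fin (m + 1)) →ₗ[ℝ] EuclideanSpace ℝ (Fin (m + 1)) →ₗ[ℝ] ℝ}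
  {W U' : Set (EuclideanSpace ℝ (Fin (m + 1)))} {μ : ℝ}

theorem mul_sqrt_mul_le_of_weight (h : IsCap f K c B) (hW : MeasurableSet W)
    (hU' : MeasurableSet U') (hWB : W ⊆ closedBall 0 1) (hU'W : U' ⊆ W)
    (hfW : ∀ z ∈ W, -1 ≤ f z) (hfU' : ∀ z ∈ U', f z ≤ 1)
    (hμ : 0 ≤ μ) (hμW : ENNReal.ofReal (2 * μ) ≤ volume W) (hμU' : ENNReal.ofReal μ ≤ volume U')
    {u : EuclideanSpace ℝ (Fin (m + 1))} (hu : ‖u‖ = 1) (θ C σ D : ℝ) (hθ : 0 ≤ θ) (hθ' : θ ≤ 1)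
    (hC : 0 ≤ C) (hCθ : 2 * (1 + θ) ^ 2 ≤ C ^ 2) (hσ : 0 ≤ σ)
    (hσC : (1 - θ) * (1 + 3 * θ) * σ ≤ 4 * θ * C) (hK : K - 1 ≤ σ ^ 2) (hD : ‖c‖ ≤ D - 1)
    (hCD : 1.0472 * (C * D) ≤ 4) :
    μ * √(B u u) * (1 + ‖c‖) ≤ 4 * (m + 1) := by
  have h1 := h.mul_sqrt_le_of_weight hW hU' hWB hU'W hfW hfU' hμ hμW hμU' hu hθ hθ' hC fun p =>
    sqrt_combination_le hθ hθ' hC hCθ hσ hσC (by linarith [h.schur_nonneg hu p])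
  have hω := unitBallVolume_le_mul m
  have hc := norm_nonneg c
  have h2 : μ * √(B u u) ≤ 1.0472 * (m + 1) * C := h1.trans (by gcongr)
  have hD' : 1 + ‖c‖ ≤ D := by linarith
  calc μ * √(B u u) * (1 + ‖c‖) ≤ 1.0472 * (m + 1) * C * D :=
        mul_le_mul h2 hD' (by positivity) (by positivity)
    _ = 1.0472 * (C * D) * (m + 1) := by ring
    _ ≤ 4 * (m + 1) := by gcongr

theorem mul_sqrt_mul_le_of_radius (h : IsCap f K c B) (hU' : MeasurableSet U')
    (hfU' : ∀ z ∈ U', |f z| ≤ 1) (hμU' : ENNReal.ofReal μ ≤ volume U') (hm : m ≠ 0)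
    {u : EuclideanSpace ℝ (Fin (m + 1))} (hu : ‖u‖ = 1) (r : ℝ) (hr : K + 1 ≤ r * (K - 1))
    (hc : ‖c‖ ≤ 1) (hR : r * (1 - ‖c‖ ^ 2) ≤ 1)
    (hc' : r * ((1 - ‖c‖ ^ 2) * (1 + ‖c‖) ^ 2) ≤ 1.8237) :
    μ * √(B u u) * (1 + ‖c‖) ≤ 4 * (m + 1) := by
  have hK := h.one_lt
  have hc0 := norm_nonneg c
  have hr0 : 0 < r := by
    by_contra! h0
    nlinarith
  have hd : 0 ≤ 1 - ‖c‖ ^ 2 := by nlinarith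
  set R := √(r * (1 - ‖c‖ ^ 2)) with hRdef
  have hR0 : 0 ≤ R := Real.sqrt_nonneg _
  have hR2 : R ^ 2 = r * (1 - ‖c‖ ^ 2) := Real.sq_sqrt (by positivity)
  have hR1 : R ≤ 1 := by nlinarith
  have h1 := h.mul_sqrt_le_of_radius hU' hfU' hμU' hu hR0 (by rw [hR2]; nlinarith)
  have hω := unitBallVolume_le_mul m
  have h2 : R * (1 + ‖c‖) * √2 * 1.0472 ≤ 2 := by
    rw [← sq_le_sq₀ (by positivity) zero_le_two]
    have : √(2 : ℝ) ^ 2 = 2 := Real.sq_sqrt zero_le_two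
    rw [mul_pow, mul_pow, mul_pow, hR2, this]
    nlinarith
  have h3 : μ * √(B u u) ≤ 1.0472 * (m + 1) * R * (2 * √2) := by
    refine h1.trans ?_
    gcongr
    exact pow_le_of_le_one hR0 hR1 hm
  calc μ * √(B u u) * (1 + ‖c‖) ≤ 1.0472 * (m + 1) * R * (2 * √2) * (1 + ‖c‖) := by
        gcongr
    _ = 2 * (R * (1 + ‖c‖) * √2 * 1.0472) * (m + 1) := by ring
    _ ≤ 2 * 2 * (m + 1) := by gcongr
    _ = 4 * (m + 1) := by ring

theorem mul_sqrt_mul_le (h : IsCap f K c B) (hW : MeasurableSet W)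
    (hU' : MeasurableSet U') (hWB : W ⊆ closedBall 0 1) (hU'W : U' ⊆ W)
    (hfW : ∀ z ∈ W, -1 ≤ f z) (hfU' : ∀ z ∈ U', f z ≤ 1)
    (hμ : 0 ≤ μ) (hμW : ENNReal.ofReal (2 * μ) ≤ volume W) (hμU' : ENNReal.ofReal μ ≤ volume U')
    {u : EuclideanSpace ℝ (Fin (m + 1))} (hu : ‖u‖ = 1) :
    μ * √(B u u) * (1 + ‖c‖) ≤ 4 * (m + 1) := by
  have hK := h.one_lt
  have hc0 := norm_nonneg c
  have hc1 : ‖c‖ ≤ 1 := by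
    have := h.norm_sq_add_le (v := 0) (by simpa using hK.le)
    simp only [norm_zero] at this
    nlinarith
  have weight := h.mul_sqrt_mul_le_of_weight hW hU' hWB hU'W hfW hfU' hμ hμW hμU' hu
  rcases le_total K 5 with h5 | h5
  · exact weight 0.35 1.9093 2 2 (by norm_num) (by norm_num) (by norm_num) (by norm_num)
      (by norm_num) (by norm_num) (by linarith) (by linarith) (by norm_num)
  rcases eq_or_ne m 0 with rfl | hm
  · have h1 := h.mul_sqrt_le_of_weight hW hU' hWB hU'W hfW hfU' hμ hμW hμU' hu zero_le_one le_rfl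
      zero_le_two fun p => by
        obtain ⟨τ, rfl⟩ : ∃ τ : ℝ, p = τ • u := by
          have hu0 : u ≠ 0 := by
            rintro rfl
            simp at hu
          obtain ⟨τ, hτ⟩ := exists_smul_eq_of_finrank_eq_one (K := ℝ) (by simp) hu0 p
          exact ⟨τ, hτ.symm⟩
        have ha : 0 < B u u := h.pos u (by rintro rfl; simp at hu)
        have hq : B (τ • u) (τ • u) - B (τ • u) u ^ 2 / B u u = 0 := by
          simp only [map_smul, LinearMap.smul_apply, smul_eq_mul]
          field_simp
          ring
        rw [hq, sub_zero]
        have h2 : √(K - 1 + 2) ≤ √(K - 1) + 1 := by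
          refine Real.sqrt_le_iff.2 ⟨by positivity, ?_⟩
          have h3 : √(K - 1) ^ 2 = K - 1 := Real.sq_sqrt (by linarith)
          have h4 : 2 ≤ √(K - 1) := Real.le_sqrt_of_sq_le (by linarith)
          nlinarith
        linarith
    rw [unitBallVolume_zero] at h1
    have : μ * √(B u u) * (1 + ‖c‖) ≤ 1 * 2 * 2 := by
      gcongr
      linarith
    simpa using this.trans (by norm_num)
  have radius := h.mul_sqrt_mul_le_of_radius hU'
    (fun z hz => abs_le.2 ⟨hfW z (hU'W hz), hfU' z hz⟩) hμU' hm hu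
  set d := ‖c‖
  rcases le_total K 12 with h12 | h12
  · rcases le_total d 0.8 with hd | hd
    · exact weight 0.5 2.1214 3.32 1.8 (by norm_num) (by norm_num) (by norm_num) (by norm_num)
        (by norm_num) (by norm_num) (by linarith) (by linarith) (by norm_num)
    · refine radius 1.5 (by linarith) hc1 (by nlinarith) ?_
      nlinarith [mul_nonneg (sub_nonneg.2 hd) (pow_nonneg hc0 2), mul_nonneg (sub_nonneg.2 hd) hc0,
        mul_nonneg (sub_nonneg.2 hd) (pow_nonneg hc0 3)]
  rcases le_total K 24 with h24 | h24
  · rcases le_total d 0.68 with hd | hd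
    · exact weight 0.6 2.2628 4.8 1.68 (by norm_num) (by norm_num) (by norm_num) (by norm_num)
        (by norm_num) (by norm_num) (by linarith) (by linarith) (by norm_num)
    · refine radius (13 / 11) (by linarith) hc1 (by nlinarith) ?_
      nlinarith [mul_nonneg (sub_nonneg.2 hd) (pow_nonneg hc0 2), mul_nonneg (sub_nonneg.2 hd) hc0,
        mul_nonneg (sub_nonneg.2 hd) (pow_nonneg hc0 3)]
  rcases le_total K 35 with h35 | h35
  · rcases le_total d 0.63 with hd | hd
    · exact weight 0.65 2.3335 5.84 1.63 (by norm_num) (by norm_num) (by norm_num) (by norm_num)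
        (by norm_num) (by norm_num) (by linarith) (by linarith) (by norm_num)
    · refine radius (25 / 23) (by linarith) hc1 (by nlinarith) ?_
      nlinarith [mul_nonneg (sub_nonneg.2 hd) (pow_nonneg hc0 2), mul_nonneg (sub_nonneg.2 hd) hc0,
        mul_nonneg (sub_nonneg.2 hd) (pow_nonneg hc0 3)]
  · rcases le_total d 0.3 with hd | hd
    · exact weight 1 2.8285 √(K - 1) 1.3 (by norm_num) (by norm_num) (by norm_num) (by norm_num)
        (Real.sqrt_nonneg _) (by norm_num) (Real.sq_sqrt (by linarith)).ge (by linarith)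
        (by norm_num)
    · refine radius (36 / 34) (by linarith) hc1 (by nlinarith) ?_
      nlinarith [mul_nonneg (sq_nonneg (d - 1 / 2)) (show 0 ≤ d ^ 2 + 3 * d + 11 / 4 by positivity)]

/-- The bound on the unit ball for a function with a large cap. -/
theorem abs_mul_sq_le (h : IsCap f K c B) (hW : MeasurableSet W)
    (hU' : MeasurableSet U') (hWB : W ⊆ closedBall 0 1) (hU'W : U' ⊆ W)
    (hfW : ∀ z ∈ W, -1 ≤ f z) (hfU' : ∀ z ∈ U', f z ≤ 1)
    (hμ : 0 ≤ μ) (hμW : ENNReal.ofReal (2 * μ) ≤ volume W) (hμU' : ENNReal.ofReal μ ≤ volume U')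
    {x : EuclideanSpace ℝ (Fin (m + 1))} (hx : x ∈ closedBall 0 1) :
    |f x| * μ ^ 2 ≤ 16 * (m + 1) ^ 2 := by
  have hK := h.one_lt
  have hc0 := norm_nonneg c
  have hfx := h.eq_sub (x - c)
  rw [add_sub_cancel] at hfx
  set v := x - c with hv
  have hpos : 0 ≤ B v v := by
    rcases eq_or_ne v 0 with h0 | h0
    · simp [h0]
    · exact (h.pos v h0).le
  rcases le_total 0 (f x) with h0 | h0
  · rw [abs_of_nonneg h0]
    have hu : ‖(EuclideanSpace.single 0 1 : EuclideanSpace ℝ (Fin (m + 1)))‖ = 1 := by simp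
    set u := (EuclideanSpace.single 0 1 : EuclideanSpace ℝ (Fin (m + 1)))
    have h1 := h.mul_sqrt_le_of_weight hW hU' hWB hU'W hfW hfU' hμ hμW hμU' hu zero_le_one le_rfl
      (show (0 : ℝ) ≤ 2.8285 by norm_num) fun p =>
        sqrt_combination_le zero_le_one le_rfl (by norm_num) (by norm_num)
          (Real.sqrt_nonneg (K - 1)) (by norm_num)
          (by rw [Real.sq_sqrt (by linarith)]; linarith [h.schur_nonneg hu p])
    have hω := unitBallVolume_le_mul m
    have h2 : μ * √(B u u) ≤ 2.97 * (m + 1) := by linarith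
    have ha := h.sub_one_le hu
    have h3 : (μ * √(B u u)) ^ 2 ≤ (2.97 * (m + 1)) ^ 2 := by gcongr
    rw [mul_pow, Real.sq_sqrt (by linarith)] at h3
    have h4 : 2 * μ ≤ 1.0472 * (m + 1 + 1) := by
      have h5 := unitBallVolume_le_mul (m + 1)
      push_cast at h5
      refine le_trans ?_ ((volume_toReal_le_unitBallVolume hWB).trans h5)
      have hfin : volume W ≠ ⊤ :=
        ((measure_mono hWB).trans_lt measure_closedBall_lt_top).ne
      exact (ENNReal.ofReal_le_iff_le_toReal hfin).1 hμW
    have h6 : μ ≤ 1.0472 * (m + 1) := by linarith [(Nat.cast_nonneg m : (0 : ℝ) ≤ m)]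
    have h7 : μ ^ 2 ≤ (1.0472 * (m + 1)) ^ 2 := by gcongr
    have h8 : f x * μ ^ 2 ≤ (1 + B u u) * μ ^ 2 := by
      gcongr
      linarith
    nlinarith
  · rw [abs_of_nonpos h0]
    have hv0 : v ≠ 0 := by
      intro hv0
      rw [hv0] at hfx
      simp at hfx
      linarith
    have hvn : 0 < ‖v‖ := norm_pos_iff.2 hv0
    have hu : ‖‖v‖⁻¹ • v‖ = 1 := by
      rw [norm_smul, norm_inv, norm_norm, inv_mul_cancel₀ hvn.ne']
    have h1 := h.mul_sqrt_mul_le hW hU' hWB hU'W hfW hfU' hμ hμW hμU' hu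
    have ha : B v v = ‖v‖ ^ 2 * B (‖v‖⁻¹ • v) (‖v‖⁻¹ • v) := by
      simp only [map_smul, LinearMap.smul_apply, smul_eq_mul]
      field_simp
    set a := B (‖v‖⁻¹ • v) (‖v‖⁻¹ • v)
    have ha0 : 0 ≤ a := by
      by_contra! hlt
      nlinarith [pow_pos hvn 2]
    have hvd : ‖v‖ ≤ 1 + ‖c‖ := (norm_sub_le x c).trans (by
      gcongr
      exact mem_closedBall_zero_iff.1 hx)
    have h2 : (μ * √a * (1 + ‖c‖)) ^ 2 ≤ (4 * (m + 1)) ^ 2 := by gcongr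
    rw [mul_pow, mul_pow, Real.sq_sqrt ha0] at h2
    calc -f x * μ ^ 2 ≤ (1 + ‖c‖) ^ 2 * a * μ ^ 2 := by
          gcongr
          calc -f x ≤ ‖v‖ ^ 2 * a := by linarith
            _ ≤ _ := by gcongr
      _ = μ ^ 2 * a * (1 + ‖c‖) ^ 2 := by ring
      _ ≤ (4 * (m + 1)) ^ 2 := h2
      _ = 16 * (m + 1) ^ 2 := by ring

end IsCap

theorem IsQuadraticFunction.continuous {E : Type*} [NormedAddCommGroup E] [NormedSpace ℝ E]
    [FiniteDimensional ℝ E] {f : E → ℝ} (hf : IsQuadraticFunction f) : Continuous f := by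
  obtain ⟨k, l, B, -, h⟩ := hf
  have hB : Continuous fun x => B x x := by
    have h1 : Continuous fun x => LinearMap.toContinuousLinearMap (B x) :=
      (LinearMap.toContinuousLinearMap.toLinearMap ∘ₗ B).continuous_of_finiteDimensional
    exact h1.clm_apply continuous_id
  rw [funext h]
  exact (continuous_const.add l.continuous_of_finiteDimensional).add hB

theorem IsLocalMax.quadratic {L Q : ℝ} (h : IsLocalMax (fun t : ℝ => t * L + t ^ 2 * Q) 0) :
    L = 0 ∧ Q ≤ 0 := by
  have hd : HasDerivAt (fun t : ℝ => t * L + t ^ 2 * Q) L 0 :=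
    (((hasDerivAt_id (0 : ℝ)).mul_const L).add
      (((hasDerivAt_id (0 : ℝ)).pow 2).mul_const Q)).congr_deriv (by simp)
  have hL := h.hasDerivAt_eq_zero hd
  refine ⟨hL, ?_⟩
  subst hL
  obtain ⟨δ, hδ, hδ'⟩ := Metric.eventually_nhds_iff.1 h
  have := hδ' (y := δ / 2) (by rw [Real.dist_eq, sub_zero, abs_of_pos (by positivity)]; linarith)
  simp only [mul_zero, zero_add, ne_eq, OfNat.ofNat_ne_zero, not_false_eq_true, zero_pow,
    zero_mul] at this
  by_contra! hQ
  have h1 : 0 < (δ / 2) ^ 2 * Q := by positivity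
  linarith

theorem IsQuadraticFunction.exists_isCap {m : ℕ} {f : EuclideanSpace ℝ (Fin (m + 1)) → ℝ}
    (hf : IsQuadraticFunction f) {U : Set (EuclideanSpace ℝ (Fin (m + 1)))} (hU : IsCompact U)
    (hUB : U ⊆ closedBall 0 1) (hfr : ∀ z ∈ frontier U, |f z| ≤ 1)
    (hz : ∃ z ∈ U, 1 < f z) :
    ∃ K c B, IsCap f K c B ∧ ∀ v, B v v < K - 1 → c + v ∈ U := by
  obtain ⟨z, hzU, hz⟩ := hz
  obtain ⟨c, hcU, hc⟩ := hU.exists_isMaxOn ⟨z, hzU⟩ hf.continuous.continuousOn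
  obtain ⟨k, l, B, hB, h⟩ := hf
  have hK : 1 < f c := hz.trans_le (hc hzU)
  have hfr' : ∀ z ∈ frontier U, f z ≤ 1 := fun z hz => (abs_le.1 (hfr z hz)).2
  have hci : c ∈ interior U := by
    rw [← self_sdiff_frontier]
    exact ⟨hcU, fun h' => (hfr' c h').not_gt hK⟩
  have hloc : IsLocalMax f c := hc.isLocalMax (mem_interior_iff_mem_nhds.1 hci)
  have hexp : ∀ v, f (c + v) = f c + (l v + 2 * B c v) + B v v := by
    intro v
    simp only [h, map_add, LinearMap.add_apply, hB v c]
    ring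
  have hcrit : ∀ v, l v + 2 * B c v = 0 ∧ B v v ≤ 0 := by
    intro v
    refine IsLocalMax.quadratic ?_
    have ht : Filter.Tendsto (fun t : ℝ => c + t • v) (nhds 0) (nhds c) := by
      have : Continuous fun t : ℝ => c + t • v := by fun_prop
      simpa using this.tendsto 0
    filter_upwards [ht.eventually hloc] with t ht
    rw [hexp] at ht
    simp only [map_smul, LinearMap.smul_apply, smul_eq_mul] at ht
    nlinarith
  have heq : ∀ v, f (c + v) = f c - (-B) v v := by
    intro v
    rw [hexp, (hcrit v).1]
    simp
  have hmem : ∀ v, (-B) v v < f c - 1 → c + v ∈ U := by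
    intro v hv
    by_contra hvU
    obtain ⟨t, ht, htU⟩ := exists_mem_frontier_segment hcU hvU
    have h1 := hfr' _ htU
    rw [heq] at h1
    have h2 := (hcrit v).2
    simp only [map_smul, LinearMap.smul_apply, LinearMap.neg_apply, smul_eq_mul] at h1 hv
    have h3 : t * t ≤ 1 := mul_le_one₀ ht.2 ht.1 ht.2
    nlinarith
  refine ⟨f c, c, -B, ⟨hK, fun x y => by simp [hB x y], heq, fun v hv => ?_,
    fun v hv => hUB (hmem v hv)⟩, hmem⟩
  rcases (hcrit v).2.lt_or_eq with h0 | h0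
  · simpa using h0
  · obtain ⟨t, -, ht⟩ := exists_mem_frontier_add_smul hU.isBounded hcU hv
    have h1 := hfr' _ ht
    rw [heq] at h1
    simp only [map_smul, LinearMap.smul_apply, LinearMap.neg_apply, smul_eq_mul, h0] at h1
    linarith

theorem IsCap.neg_one_le {m : ℕ} {f : EuclideanSpace ℝ (Fin (m + 1)) → ℝ} {K : ℝ}
    {c : EuclideanSpace ℝ (Fin (m + 1))}
    {B : EuclideanSpace ℝ (Fin (m + 1)) →ₗ[ℝ] EuclideanSpace ℝ (Fin (m + 1)) →ₗ[ℝ] ℝ}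
    (h : IsCap f K c B) {U : Set (EuclideanSpace ℝ (Fin (m + 1)))} (hU : Bornology.IsBounded U)
    (hfr : ∀ z ∈ frontier U, |f z| ≤ 1) {w : EuclideanSpace ℝ (Fin (m + 1))} (hw : w ∈ U) :
    -1 ≤ f w := by
  have hK := h.one_lt
  have hfw := h.eq_sub (w - c)
  rw [add_sub_cancel] at hfw
  rcases eq_or_ne (w - c) 0 with h0 | h0
  · rw [h0] at hfw
    simp only [map_zero, sub_zero] at hfw
    linarith
  obtain ⟨t, ht, htU⟩ := exists_mem_frontier_add_smul hU hw h0
  have h1 := (abs_le.1 (hfr _ htU)).1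
  have h2 : w + t • (w - c) = c + (1 + t) • (w - c) := by
    rw [add_smul, one_smul]
    abel
  rw [h2, h.eq_sub] at h1
  simp only [map_smul, LinearMap.smul_apply, smul_eq_mul] at h1
  have h3 := h.pos _ h0
  nlinarith [mul_nonneg ht h3.le, mul_nonneg ht (mul_nonneg ht h3.le)]

section

variable {m : ℕ} {f : EuclideanSpace ℝ (Fin (m + 1)) → ℝ}
  {U U' : Set (EuclideanSpace ℝ (Fin (m + 1)))} {μ : ℝ}

theorem ofReal_two_mul_le_volume_union (hU' : IsCompact U')
    (hdisj : Disjoint U U') (hμ : 0 ≤ μ) (hμU : μ ≤ (volume U).toReal)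
    (hμU' : μ ≤ (volume U').toReal) : ENNReal.ofReal (2 * μ) ≤ volume (U ∪ U') := by
  rw [measure_union hdisj hU'.measurableSet, two_mul, ENNReal.ofReal_add hμ hμ]
  gcongr
  · exact ENNReal.ofReal_le_of_le_toReal hμU
  · exact ENNReal.ofReal_le_of_le_toReal hμU'

theorem IsQuadraticFunction.abs_mul_sq_le_of_one_lt (hf : IsQuadraticFunction f)
    (hU : IsCompact U) (hU' : IsCompact U') (hUB : U ⊆ closedBall 0 1) (hUB' : U' ⊆ closedBall 0 1)
    (hdisj : Disjoint U U') (hfr : ∀ z ∈ frontier U, |f z| ≤ 1)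
    (hfr' : ∀ z ∈ frontier U', |f z| ≤ 1) (hμ : 0 ≤ μ) (hμU : μ ≤ (volume U).toReal)
    (hμU' : μ ≤ (volume U').toReal) (hz : ∃ z ∈ U, 1 < |f z|)
    {x : EuclideanSpace ℝ (Fin (m + 1))} (hx : x ∈ closedBall 0 1) :
    |f x| * μ ^ 2 ≤ 16 * (m + 1) ^ 2 := by
  wlog hz' : ∃ z ∈ U, 1 < f z generalizing f
  · obtain ⟨z, hzU, hz1⟩ := hz
    have := this (f := fun x => -1 * f x) (hf.const_mul (-1)) (by simpa using hfr)
      (by simpa using hfr') ⟨z, hzU, by simpa using hz1⟩ ⟨z, hzU, by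
        rcases lt_abs.1 hz1 with h1 | h1
        · exact absurd ⟨z, hzU, h1⟩ hz'
        · simpa using h1⟩
    simpa using this
  obtain ⟨K, c, B, h, hmem⟩ := hf.exists_isCap hU hUB hfr hz'
  refine h.abs_mul_sq_le (W := U ∪ U') (U' := U') (hU.union hU').measurableSet hU'.measurableSet
    (Set.union_subset hUB hUB') Set.subset_union_right ?_ (fun z hzU' => ?_) hμ
    (ofReal_two_mul_le_volume_union hU' hdisj hμ hμU hμU')
    (ENNReal.ofReal_le_of_le_toReal hμU') hx
  · rintro z (hz | hz)
    · exact h.neg_one_le hU.isBounded hfr hz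
    · exact h.neg_one_le hU'.isBounded hfr' hz
  · by_contra! hlt
    have h1 := h.eq_sub (z - c)
    rw [add_sub_cancel] at h1
    have h2 := hmem (z - c) (by linarith)
    rw [add_sub_cancel] at h2
    exact Set.disjoint_left.1 hdisj h2 hzU'

theorem IsQuadraticFunction.abs_mul_sq_le (hf : IsQuadraticFunction f)
    (hU : IsCompact U) (hU' : IsCompact U') (hUB : U ⊆ closedBall 0 1) (hUB' : U' ⊆ closedBall 0 1)
    (hdisj : Disjoint U U') (hfr : ∀ z ∈ frontier U ∪ frontier U', |f z| ≤ 1) (hμ : 0 < μ)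
    (hμU : μ ≤ (volume U).toReal) (hμU' : μ ≤ (volume U').toReal)
    {x : EuclideanSpace ℝ (Fin (m + 1))} (hx : x ∈ closedBall 0 1) :
    |f x| * μ ^ 2 ≤ 16 * (m + 1) ^ 2 := by
  have h1 : ∀ z ∈ frontier U, |f z| ≤ 1 := fun z hz => hfr z (Or.inl hz)
  have h2 : ∀ z ∈ frontier U', |f z| ≤ 1 := fun z hz => hfr z (Or.inr hz)
  by_cases hz : ∃ z ∈ U, 1 < |f z|
  · exact hf.abs_mul_sq_le_of_one_lt hU hU' hUB hUB' hdisj h1 h2 hμ.le hμU hμU' hz hx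
  by_cases hz' : ∃ z ∈ U', 1 < |f z|
  · exact hf.abs_mul_sq_le_of_one_lt hU' hU hUB' hUB hdisj.symm h2 h1 hμ.le hμU' hμU hz' hx
  push Not at hz hz'
  obtain ⟨y, hy⟩ : U.Nonempty := by
    by_contra! h0
    simp only [h0, measure_empty, ENNReal.toReal_zero] at hμU
    linarith
  have hr := remez_quadratic (hU.union hU').measurableSet (Set.union_subset hUB hUB') hf
    (fun z hz0 => hz0.elim (hz z) (hz' z)) hx (Set.mem_union_left U' hy)
  have hv : 2 * μ ≤ (volume (U ∪ U')).toReal :=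
    (ENNReal.ofReal_le_iff_le_toReal (hU.union hU').measure_ne_top).1
      (ofReal_two_mul_le_volume_union hU' hdisj hμ.le hμU hμU')
  have h3 : |f x| * (2 * μ) ^ 2 ≤ |f x| * (volume (U ∪ U')).toReal ^ 2 := by gcongr
  linarith

theorem IsQuadraticFunction.abs_le_mul (hf : IsQuadraticFunction f)
    (hU : IsCompact U) (hU' : IsCompact U') (hUB : U ⊆ closedBall 0 1) (hUB' : U' ⊆ closedBall 0 1)
    (hdisj : Disjoint U U') {S : ℝ} (hS : 0 ≤ S) (hfr : ∀ z ∈ frontier U ∪ frontier U', |f z| ≤ S)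
    (hμ : 0 < μ) (hμU : μ ≤ (volume U).toReal) (hμU' : μ ≤ (volume U').toReal)
    {x : EuclideanSpace ℝ (Fin (m + 1))} (hx : x ∈ closedBall 0 1) :
    |f x| ≤ (4 * (m + 1) / μ) ^ 2 * S := by
  have key : ∀ T, S < T → |f x| ≤ (4 * (m + 1) / μ) ^ 2 * T := by
    intro T hT
    have hT0 : 0 < T := hS.trans_lt hT
    have h1 := (hf.const_mul T⁻¹).abs_mul_sq_le hU hU' hUB hUB' hdisj (fun z hz => by
      rw [abs_mul, abs_inv, abs_of_pos hT0]
      exact inv_mul_le_one_of_le₀ ((hfr z hz).trans hT.le) hT0.le) hμ hμU hμU' hx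
    rw [abs_mul, abs_inv, abs_of_pos hT0] at h1
    rw [div_pow, div_mul_eq_mul_div, le_div_iff₀ (by positivity)]
    calc |f x| * μ ^ 2 = T⁻¹ * |f x| * μ ^ 2 * T := by field_simp
      _ ≤ 16 * (m + 1) ^ 2 * T := by gcongr
      _ = (4 * (m + 1)) ^ 2 * T := by ring
  have hpos : 0 < (4 * (m + 1 : ℝ) / μ) ^ 2 := by positivity
  rw [← div_le_iff₀' hpos]
  exact le_of_forall_gt_imp_ge_of_dense fun T hT => (div_le_iff₀' hpos).2 (key T hT)

end

theorem le_biSup_of_isCompact {X : Type*} [TopologicalSpace X] {f : X → ℝ} (hf : Continuous f)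
    {s : Set X} (hs : IsCompact s) {z : X} (hz : z ∈ s) (h0 : ∀ z, 0 ≤ f z) :
    f z ≤ ⨆ z ∈ s, f z := by
  obtain ⟨C, hC⟩ := (hs.image hf).bddAbove
  have hC0 : 0 ≤ C := (h0 z).trans (hC ⟨z, hz, rfl⟩)
  have hbdd : BddAbove (Set.range fun z => ⨆ _ : z ∈ s, f z) := by
    refine ⟨C, ?_⟩
    rintro _ ⟨y, rfl⟩
    exact Real.iSup_le (fun hy => hC ⟨y, hy, rfl⟩) hC0
  calc f z = ⨆ _ : z ∈ s, f z := by simp [hz]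
    _ ≤ _ := le_ciSup hbdd z

theorem stmt16 (n : ℕ) (hn : 1 ≤ n)
    (U₁ U₂ : Set (EuclideanSpace ℝ (Fin n)))
    (hU₁sub : U₁ ⊆ closedBall 0 1) (hU₂sub : U₂ ⊆ closedBall 0 1)
    (hU₁comp : IsCompact U₁) (hU₂comp : IsCompact U₂)
    (hU₁conn : IsConnected U₁) (hU₂conn : IsConnected U₂)
    (hU₁int : (interior U₁).Nonempty) (hU₂int : (interior U₂).Nonempty)
    (hdisj : Disjoint U₁ U₂)
    (hμ₂ : 0 < (volume U₂).toReal)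
    (hμ : (volume U₂).toReal ≤ (volume U₁).toReal)
    (P : MvPolynomial (Fin n) ℝ) (hdeg : P.totalDegree ≤ 2) :
    (⨆ x ∈ closedBall (0 : EuclideanSpace ℝ (Fin n)) 1,
        |MvPolynomial.eval (fun i => x i) P|) ≤
      (4 * n / (volume U₂).toReal) ^ 2 *
        ⨆ z ∈ frontier U₁ ∪ frontier U₂, |MvPolynomial.eval (fun i => z i) P| := by
  obtain ⟨m, rfl⟩ : ∃ m, n = m + 1 := ⟨n - 1, by omega⟩
  have hf := P.isQuadraticFunction_eval hdeg
  have hZ : IsCompact (frontier U₁ ∪ frontier U₂) :=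
    (hU₁comp.of_isClosed_subset isClosed_frontier hU₁comp.isClosed.frontier_subset).union
      (hU₂comp.of_isClosed_subset isClosed_frontier hU₂comp.isClosed.frontier_subset)
  have hS : 0 ≤ ⨆ z ∈ frontier U₁ ∪ frontier U₂, |MvPolynomial.eval (fun i => z i) P| := Real.iSup_nonneg fun z => Real.iSup_nonneg fun _ => abs_nonneg _
  have hRHS := mul_nonneg (sq_nonneg (4 * ((m + 1 : ℕ) : ℝ) / (volume U₂).toReal)) hS
  refine Real.iSup_le (fun x => Real.iSup_le (fun hx => ?_) hRHS) hRHS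
  have hfr : ∀ z ∈ frontier U₁ ∪ frontier U₂, |MvPolynomial.eval (fun i => z i) P| ≤
      ⨆ z ∈ frontier U₁ ∪ frontier U₂, |MvPolynomial.eval (fun i => z i) P| := fun z hz =>
    le_biSup_of_isCompact hf.continuous.abs hZ hz fun _ => abs_nonneg _
  rw [Nat.cast_succ]
  exact hf.abs_le_mul hU₁comp hU₂comp hU₁sub hU₂sub hdisj hS hfr hμ₂ hμ le_rfl hx
end

section
/- Let P be a real polynomial of degree d ≥ 1 in n variables. Then the number of nondegenerate critical points of P (points x ∈ R^n where the gradient of P vanishes and the Hessian of P is nonsingular) is at most (d−1)^n. -/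
/-- The set of nondegenerate critical points of a polynomial `P` in `n` variables:
points where the gradient vanishes and the Hessian matrix is nonsingular. -/
def nondegCritSet (n : ℕ) (P : MvPolynomial (Fin n) ℝ) : Set (Fin n → ℝ) :=
  { x | (∀ i, MvPolynomial.eval x (MvPolynomial.pderiv i P) = 0) ∧
    (Matrix.of fun i j =>
      MvPolynomial.eval x (MvPolynomial.pderiv i (MvPolynomial.pderiv j P))).det ≠ 0 }

namespace MvPolynomial

open Finset

lemma IsHomogeneous.aeval_mul_left {R S σ : Type*} [CommSemiring R] [CommSemiring S] [Algebra R S]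
    [Fintype σ] {F : MvPolynomial σ R} {m : ℕ} (hF : F.IsHomogeneous m) (t : S) (h : σ → S) :
    MvPolynomial.aeval (fun j => t * h j) F = t ^ m * MvPolynomial.aeval h F := by
  rw [aeval_def, aeval_def, eval₂_eq', eval₂_eq', mul_sum]
  refine sum_congr rfl fun d hd => ?_
  have hdeg : ∑ i, d i = m := by
    rw [← Finsupp.degree_eq_sum]
    by_contra hne
    exact (mem_support_iff.mp hd) (hF.coeff_eq_zero hne)
  simp only [mul_pow, prod_mul_distrib, prod_pow_eq_pow_sum, hdeg]
  ring

lemma exists_aeval_X_mul_eq {K σ : Type*} [Field K] [Fintype σ] (h : σ → Polynomial K)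
    (G : MvPolynomial σ K) (k : ℕ) (hG : ∀ m < k, homogeneousComponent m G = 0) :
    ∃ r : Polynomial K, aeval (fun j => Polynomial.X * h j) G = Polynomial.X ^ k * r ∧
      r.eval 0 = eval (fun j => (h j).eval 0) (homogeneousComponent k G) := by
  refine ⟨∑ m ∈ range (G.totalDegree + 1),
    Polynomial.X ^ (m - k) * aeval h (homogeneousComponent m G), ?_, ?_⟩
  · conv_lhs => rw [← sum_homogeneousComponent G]
    rw [map_sum, mul_sum]
    refine sum_congr rfl fun m _ => ?_
    rcases lt_or_ge m k with hm | hm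
    · simp [hG m hm]
    · rw [(homogeneousComponent_isHomogeneous m G).aeval_mul_left, ← mul_assoc, ← pow_add,
        Nat.add_sub_cancel' hm]
  · have key : ∀ F : MvPolynomial σ K,
        (aeval h F).eval 0 = eval (fun j => (h j).eval 0) F := fun F => by
      induction F using MvPolynomial.induction_on with
      | C a => simp
      | add F G hF hG => simp [hF, hG]
      | mul_X F i hF => simp [hF]
    rw [Polynomial.eval_finsetSum, sum_eq_single k]
    · simp [key]
    · intro m _ hmk
      rcases lt_or_gt_of_ne hmk with hm | hm
      · simp [hG m hm]
      · simp [zero_pow (Nat.sub_ne_zero_of_lt hm)]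
    · intro hk
      rw [homogeneousComponent_eq_zero k G (by simpa using hk)]
      simp

/-- Restriction of a polynomial to the parametrized line `p + T v`. -/
noncomputable def restrictLine {K σ : Type*} [Field K] (p v : σ → K) :
    MvPolynomial σ K →ₐ[K] Polynomial K :=
  aeval fun i => Polynomial.C (p i) + Polynomial.X * Polynomial.C (v i)

lemma eval_zero_restrictLine {K σ : Type*} [Field K] (p v : σ → K) (F : MvPolynomial σ K) :
    (restrictLine p v F).eval 0 = eval p F := by
  induction F using MvPolynomial.induction_on with
  | C a => simp [restrictLine]
  | add F G hF hG => simp [hF, hG]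
  | mul_X F i hF => simp [hF]; simp [restrictLine]

lemma derivative_restrictLine {K σ : Type*} [Field K] [Fintype σ] (p v : σ → K)
    (F : MvPolynomial σ K) :
    Polynomial.derivative (restrictLine p v F) =
      ∑ i, restrictLine p v (pderiv i F) * Polynomial.C (v i) := by
  classical
  induction F using MvPolynomial.induction_on with
  | C a => simp [restrictLine]
  | add F G hF hG => simp [hF, hG, add_mul, sum_add_distrib]
  | mul_X F j hF =>
    have hX : Polynomial.derivative (restrictLine p v (X j)) = Polynomial.C (v j) := by
      simp [restrictLine]
    have hterm : ∀ i, restrictLine p v (pderiv i (F * X j)) * Polynomial.C (v i) =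
        restrictLine p v (pderiv i F) * Polynomial.C (v i) * restrictLine p v (X j) +
          if j = i then restrictLine p v F * Polynomial.C (v j) else 0 := fun i => by
      rw [Derivation.leibniz, map_add, smul_eq_mul, smul_eq_mul, map_mul, map_mul]
      split_ifs with h
      · subst h
        rw [pderiv_X_self, map_one]
        ring
      · rw [pderiv_X_of_ne h, map_zero]
        ring
    rw [map_mul, Polynomial.derivative_mul, hF, hX, sum_congr rfl fun i _ => hterm i,
      sum_add_distrib, sum_mul, sum_ite_eq, if_pos (mem_univ j)]

lemma exists_restrictLine_eq_X_mul {K σ : Type*} [Field K] [Fintype σ] (p v : σ → K)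
    (F : MvPolynomial σ K) (hF : eval p F = 0) :
    ∃ h : Polynomial K, restrictLine p v F = Polynomial.X * h ∧
      h.eval 0 = ∑ i, eval p (pderiv i F) * v i := by
  obtain ⟨h, hh⟩ : Polynomial.X ∣ restrictLine p v F := by
    rw [Polynomial.X_dvd_iff, Polynomial.coeff_zero_eq_eval_zero, eval_zero_restrictLine, hF]
  refine ⟨h, hh, ?_⟩
  have hd := congrArg (Polynomial.eval 0) (derivative_restrictLine p v F)
  rw [hh] at hd
  simpa [Polynomial.eval_finsetSum, eval_zero_restrictLine] using hd

/-- If `∑ e q * G q (f)` vanishes and every `G q` vanishes to order `k`, then so does the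
leading form of this sum at a common zero of the `f j`, along any direction. -/
lemma sum_eval_mul_eval_homogeneousComponent {K σ ι τ : Type*} [Field K] [Fintype σ] [Fintype τ]
    [Fintype ι] (f : τ → MvPolynomial σ K) (e : ι → MvPolynomial σ K) (G : ι → MvPolynomial τ K)
    (hsum : ∑ q, e q * aeval f (G q) = 0) (p : σ → K) (hp : ∀ j, eval p (f j) = 0) (k : ℕ)
    (hG : ∀ q, ∀ m < k, homogeneousComponent m (G q) = 0) (v : σ → K) :
    ∑ q, eval p (e q) *
      eval (fun j => ∑ i, eval p (pderiv i (f j)) * v i) (homogeneousComponent k (G q)) = 0 := by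
  choose h hh hh0 using fun j => exists_restrictLine_eq_X_mul p v (f j) (hp j)
  choose r hr hr0 using fun q => exists_aeval_X_mul_eq h (G q) k (hG q)
  have key : ∀ F : MvPolynomial τ K,
      restrictLine p v (aeval f F) = aeval (fun j => Polynomial.X * h j) F := fun F => by
    rw [← AlgHom.comp_apply, comp_aeval]
    simp only [← hh]
  have h0 := congrArg (restrictLine p v) hsum
  simp only [map_sum, map_mul, key, hr, map_zero] at h0
  have h1 : Polynomial.X ^ k * ∑ q, restrictLine p v (e q) * r q = 0 := by
    rw [← h0, mul_sum]
    exact sum_congr rfl fun q _ => by ring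
  have h2 := congrArg (Polynomial.eval 0)
    ((mul_eq_zero.mp h1).resolve_left (pow_ne_zero _ Polynomial.X_ne_zero))
  simpa [Polynomial.eval_finsetSum, eval_zero_restrictLine, hr0, hh0] using h2

/-- Polynomials separating the common zeros of `f` at which the Jacobian determinant is nonzero
are linearly independent over `K[f]`. -/
lemma eq_zero_of_sum_mul_aeval_eq_zero {K ι σ : Type*} [Field K] [Infinite K] [Fintype ι]
    [Fintype σ] [DecidableEq σ] (f : σ → MvPolynomial σ K) (pt : ι → σ → K)
    (hpt : ∀ q j, eval (pt q) (f j) = 0)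
    (hJ : ∀ q, (Matrix.of fun i j => eval (pt q) (pderiv i (f j))).det ≠ 0)
    (e : ι → MvPolynomial σ K) (he : ∀ q, eval (pt q) (e q) ≠ 0)
    (he' : ∀ q q', q' ≠ q → eval (pt q) (e q') = 0) (G : ι → MvPolynomial σ K)
    (hsum : ∑ q, e q * aeval f (G q) = 0) : G = 0 := by
  have hcomp : ∀ k q, homogeneousComponent k (G q) = 0 := by
    intro k
    induction k using Nat.strong_induction_on with
    | _ k ih =>
    intro q
    refine (homogeneousComponent_isHomogeneous k (G q)).eq_zero_of_forall_eval_eq_zero fun w => ?_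
    set M := Matrix.of fun i j => eval (pt q) (pderiv i (f j)) with hM
    have hw : (fun j => ∑ i, eval (pt q) (pderiv i (f j)) * (Matrix.vecMul w M⁻¹) i) = w := by
      have : Matrix.vecMul (Matrix.vecMul w M⁻¹) M = w := by
        rw [Matrix.vecMul_vecMul, Matrix.nonsing_inv_mul _ (isUnit_iff_ne_zero.mpr (hJ q)),
          Matrix.vecMul_one]
      conv_rhs => rw [← this]
      ext j
      simp [Matrix.vecMul, dotProduct, hM, mul_comm]
    have h := sum_eval_mul_eval_homogeneousComponent f e G hsum (pt q) (hpt q) k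
      (fun q m hm => ih m hm q) (Matrix.vecMul w M⁻¹)
    rw [hw, sum_eq_single q (fun q' _ hq' => by simp [he' q q' hq']) (by simp)] at h
    exact (mul_eq_zero.mp h).resolve_left (he q)
  funext q
  rw [← sum_homogeneousComponent (G q)]
  simp [hcomp]

lemma exists_eval_ne_zero_and_eval_eq_zero {K σ : Type*} [Field K] (S : Finset (σ → K))
    (p : σ → K) : ∃ e : MvPolynomial σ K, eval p e ≠ 0 ∧ ∀ q ∈ S, q ≠ p → eval q e = 0 := by
  classical
  have hsep : ∀ q : σ → K, ∃ l : MvPolynomial σ K, eval q l = 0 ∧ (q ≠ p → eval p l ≠ 0) := by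
    intro q
    by_cases hq : q = p
    · exact ⟨0, by simp [hq]⟩
    · obtain ⟨i, hi⟩ := Function.ne_iff.mp hq
      exact ⟨X i - C (q i), by simp, fun _ => by simpa [sub_eq_zero] using hi.symm⟩
  choose l hl hl' using hsep
  refine ⟨∏ q ∈ S.erase p, l q, ?_, fun q hq hqp => ?_⟩
  · rw [map_prod, prod_ne_zero_iff]
    exact fun q hq => hl' q (ne_of_mem_erase hq)
  · rw [map_prod]
    exact prod_eq_zero (mem_erase.mpr ⟨hqp, hq⟩) (hl q)

lemma totalDegree_aeval_le {K σ τ : Type*} [CommSemiring K] (f : τ → MvPolynomial σ K) (D : ℕ)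
    (hf : ∀ j, (f j).totalDegree ≤ D) (G : MvPolynomial τ K) :
    (aeval f G).totalDegree ≤ D * G.totalDegree := by
  rw [aeval_def, eval₂_eq]
  refine totalDegree_finsetSum_le fun d hd => (totalDegree_mul _ _).trans ?_
  rw [algebraMap_eq, totalDegree_C, zero_add]
  refine (totalDegree_finsetProd _ _).trans ?_
  calc ∑ i ∈ d.support, (f i ^ d i).totalDegree ≤ ∑ i ∈ d.support, D * d i :=
        sum_le_sum fun i _ => (totalDegree_pow _ _).trans <| by
          rw [mul_comm]; exact Nat.mul_le_mul_right _ (hf i)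
    _ = D * d.sum fun _ a => a := by rw [Finsupp.sum, mul_sum]
    _ ≤ D * G.totalDegree := Nat.mul_le_mul_left _ (le_totalDegree hd)

lemma sum_range_multichoose (n s : ℕ) :
    ∑ k ∈ range (s + 1), n.multichoose k = (n + 1).multichoose s := by
  induction s with
  | zero => simp
  | succ s ih => rw [sum_range_succ, ih, Nat.multichoose_succ_succ, add_comm]

lemma finrank_restrictTotalDegree (K : Type*) [Field K] (n s : ℕ) :
    Module.finrank K (restrictTotalDegree (Fin n) K s) = (s + n).choose n := by
  classical
  have hset : {d : Fin n →₀ ℕ | (d.sum fun _ e => e) ≤ s} =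
      ((range (s + 1)).biUnion fun k => (univ : Finset (Fin n)).finsuppAntidiag k :
        Finset (Fin n →₀ ℕ)) := by
    ext d
    simp [Finsupp.sum_fintype, mem_finsuppAntidiag]
  rw [restrictTotalDegree, Module.finrank_eq_nat_card_basis (basisRestrictSupport K _), Nat.card_coe_set_eq, hset,
    Set.ncard_coe_finset, card_biUnion]
  · simp only [card_finsuppAntidiag_nat_eq_multichoose, card_univ, Fintype.card_fin]
    rw [sum_range_multichoose, Nat.multichoose_eq, Nat.choose_symm_of_eq_add]
    · congr 1; omega
    · omega
  · intro k _ l _ hkl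
    rw [Function.onFun, disjoint_left]
    intro d hk hl
    rw [mem_finsuppAntidiag] at hk hl
    exact hkl (hk.1.symm.trans hl.1)

lemma le_pow_of_forall_mul_pow_le {N D n c : ℕ}
    (h : ∀ s : ℕ, N * (s + 1) ^ n ≤ (D * s + c) ^ n) : N ≤ D ^ n := by
  have hlim : Filter.Tendsto (fun s : ℕ => ((D : ℝ) + c * (1 / ((s : ℝ) + 1))) ^ n) Filter.atTop
      (nhds ((D : ℝ) ^ n)) := by
    simpa using ((tendsto_one_div_add_atTop_nhds_zero_nat (𝕜 := ℝ)).const_mul (c : ℝ)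
      |>.const_add (D : ℝ)).pow n
  have hle : (N : ℝ) ≤ (D : ℝ) ^ n := by
    refine ge_of_tendsto' hlim fun s => ?_
    have hs : (0 : ℝ) < (s : ℝ) + 1 := by positivity
    have h1 : (N : ℝ) * ((s : ℝ) + 1) ^ n ≤ ((D : ℝ) * s + c) ^ n := by exact_mod_cast h s
    refine le_of_mul_le_mul_right (h1.trans ?_) (pow_pos hs n)
    rw [← mul_pow]
    refine pow_le_pow_left₀ (by positivity) ?_ n
    field_simp
    nlinarith [Nat.cast_nonneg (α := ℝ) D]
  exact_mod_cast hle

/-- Bézout bound for nondegenerate common zeros. -/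
theorem card_le_pow_of_det_jacobian_ne_zero {K : Type*} [Field K] [Infinite K] (n D : ℕ)
    (f : Fin n → MvPolynomial (Fin n) K) (hf : ∀ j, (f j).totalDegree ≤ D)
    (S : Finset (Fin n → K)) (hS : ∀ p ∈ S, ∀ j, eval p (f j) = 0)
    (hJ : ∀ p ∈ S, (Matrix.of fun i j => eval p (pderiv i (f j))).det ≠ 0) :
    S.card ≤ D ^ n := by
  choose e he he' using exists_eval_ne_zero_and_eval_eq_zero S
  set c := S.sup fun p => (e p).totalDegree with hc
  refine le_pow_of_forall_mul_pow_le (c := c + n) fun s => ?_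
  let Φ : (S → restrictTotalDegree (Fin n) K s) →ₗ[K] MvPolynomial (Fin n) K :=
    ∑ p : S, LinearMap.mulLeft K (e p) ∘ₗ (aeval f).toLinearMap ∘ₗ
      (restrictTotalDegree (Fin n) K s).subtype ∘ₗ LinearMap.proj p
  have hΦ : ∀ G, Φ G = ∑ p : S, e p * aeval f (G p : MvPolynomial (Fin n) K) := fun G => by
    simp [Φ, LinearMap.sum_apply]
  have hmem : ∀ G, Φ G ∈ restrictTotalDegree (Fin n) K (D * s + c) := fun G => by
    rw [mem_restrictTotalDegree, hΦ]
    refine totalDegree_finsetSum_le fun p _ => (totalDegree_mul _ _).trans ?_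
    rw [add_comm]
    exact add_le_add ((totalDegree_aeval_le f D hf _).trans
      (Nat.mul_le_mul_left _ ((mem_restrictTotalDegree _ _ _).mp (G p).2)))
      (le_sup (f := fun p => (e p).totalDegree) p.2)
  have hinj : Function.Injective (Φ.codRestrict _ hmem) := by
    rw [← LinearMap.ker_eq_bot, LinearMap.ker_codRestrict, LinearMap.ker_eq_bot']
    intro G hG
    rw [hΦ] at hG
    have := eq_zero_of_sum_mul_aeval_eq_zero f (fun p : S => (p : Fin n → K))
      (fun p => hS p p.2) (fun p => hJ p p.2) (fun p => e p) (fun p => he p)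
      (fun p q hq => he' q p p.2 fun h => hq (Subtype.ext h.symm))
      (fun p => (G p : MvPolynomial (Fin n) K)) hG
    funext p
    exact Subtype.ext (congrFun this p)
  have hrank := LinearMap.finrank_le_finrank_of_injective hinj
  rw [Module.finrank_pi_fintype] at hrank
  simp only [finrank_restrictTotalDegree, sum_const, card_univ, Fintype.card_coe,
    smul_eq_mul] at hrank
  calc S.card * (s + 1) ^ n ≤ S.card * (s + 1).ascFactorial n :=
        Nat.mul_le_mul_left _ (Nat.pow_succ_le_ascFactorial _ _)
    _ = n.factorial * (S.card * (s + n).choose n) := by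
        rw [Nat.ascFactorial_eq_factorial_mul_choose]; ring
    _ ≤ n.factorial * (D * s + c + n).choose n := Nat.mul_le_mul_left _ hrank
    _ = (D * s + c + 1).ascFactorial n := (Nat.ascFactorial_eq_factorial_mul_choose _ _).symm
    _ ≤ (D * s + (c + n)) ^ n := by
        rw [← add_assoc]; exact Nat.ascFactorial_le_pow_add _ _

lemma totalDegree_pderiv_le_sub_one {R σ : Type*} [CommSemiring R] (i : σ)
    (P : MvPolynomial σ R) : (pderiv i P).totalDegree ≤ P.totalDegree - 1 := by
  classical
  conv_lhs => rw [P.as_sum, map_sum]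
  refine totalDegree_finsetSum_le fun d hd => ?_
  rw [pderiv_monomial]
  by_cases hdi : d i = 0
  · simp [hdi]
  refine (totalDegree_monomial_le _ _).trans ?_
  have hle : Finsupp.single i 1 ≤ d := by
    simpa [Finsupp.single_le_iff] using Nat.one_le_iff_ne_zero.mpr hdi
  have hdeg : d.degree ≤ P.totalDegree := le_totalDegree hd
  have hadd := congrArg Finsupp.degree (tsub_add_cancel_of_le hle)
  rw [map_add, Finsupp.degree_single] at hadd
  change (d - Finsupp.single i 1).degree ≤ _
  omega

end MvPolynomial

theorem stmt18 (n d : ℕ) (hd : 1 ≤ d) (P : MvPolynomial (Fin n) ℝ)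
    (hdeg : P.totalDegree = d) :
    (nondegCritSet n P).Finite ∧ (nondegCritSet n P).ncard ≤ (d - 1) ^ n := by
  have hcard : ∀ S : Finset (Fin n → ℝ), ↑S ⊆ nondegCritSet n P → S.card ≤ (d - 1) ^ n :=
    fun S hS => MvPolynomial.card_le_pow_of_det_jacobian_ne_zero n (d - 1)
      (fun j => MvPolynomial.pderiv j P)
      (fun j => hdeg ▸ MvPolynomial.totalDegree_pderiv_le_sub_one j P) S
      (fun p hp => (hS hp).1) (fun p hp => (hS hp).2)
  have hfin : (nondegCritSet n P).Finite := by
    by_contra hinf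
    obtain ⟨S, hS, hSc⟩ := Set.Infinite.exists_subset_card_eq hinf ((d - 1) ^ n + 1)
    have := hcard S hS
    omega
  refine ⟨hfin, ?_⟩
  rw [Set.ncard_eq_toFinset_card _ hfin]
  exact hcard _ (by simp)
end

section
/- For all positive integers n and d there exist constants C_1(n,d) and C_2(n,d) with the following property: for every C^{d+1} function f on the closed unit ball B^n ⊂ R^n and every k = 1, 2, ..., d, one has M_k(f) ≤ C_1(n,d) · M_0(f) + C_2(n,d) · M_{d+1}(f). -/
open Metric

/-- `Mder n l f` : the maximum over the closed unit ball of the sum of absolute values of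
all partial derivatives of order `l` of `f`. -/
noncomputable def Mder (n l : ℕ) (f : EuclideanSpace ℝ (Fin n) → ℝ) : ℝ :=
  ⨆ z ∈ closedBall (0 : EuclideanSpace ℝ (Fin n)) 1,
    ∑ m : Fin l → Fin n,
      |iteratedFDerivWithin ℝ l f (closedBall 0 1) z (fun i => EuclideanSpace.single (m i) 1)|

theorem exists_interpolation_constant (d : ℕ) (ε : ℝ) (hε : 0 < ε) :
    ∃ C : ℝ, 0 < C ∧ ∀ a : ℕ → ℝ, (∀ k, 0 ≤ a k) →
      (∀ k, k + 1 ≤ d → ∀ h : ℝ, 0 < h → h ≤ 1 →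
        a (k + 1) ≤ 2 / h * a k + 4 * h * a (k + 2)) →
      ∀ k ≤ d, a k ≤ C * a 0 + ε * a (d + 1) := by
  induction d generalizing ε with
  | zero =>
    refine ⟨1, one_pos, fun a ha _ k hk => ?_⟩
    obtain rfl : k = 0 := by lia
    have := mul_nonneg hε.le (ha (0 + 1))
    linarith
  | succ d ih =>
    obtain ⟨h, hpos, hle, hhε⟩ : ∃ h : ℝ, 0 < h ∧ h ≤ 1 ∧ 8 * h ≤ ε :=
      ⟨min 1 (ε / 8), by positivity, min_le_left _ _, by
        linarith [min_le_right 1 (ε / 8)]⟩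
    obtain ⟨C, hC, ihC⟩ := ih (h / 4) (by positivity)
    refine ⟨C + 4 * C / h, by positivity, fun a ha step k hk => ?_⟩
    have low := ihC a ha (fun k hk => step k (by lia))
    have top : a (d + 1) ≤ 4 * C / h * a 0 + 8 * h * a (d + 2) := by
      have h1 := step d le_rfl h hpos hle
      have h2 := mul_le_mul_of_nonneg_left (low d le_rfl) (show 0 ≤ 2 / h by positivity)
      have h3 : 2 / h * (C * a 0 + h / 4 * a (d + 1)) = 2 * C / h * a 0 + a (d + 1) / 2 := by
        field_simp
        ring
      have h4 : 4 * C / h * a 0 = 2 * (2 * C / h * a 0) := by ring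
      linarith
    have h5 := mul_le_mul_of_nonneg_right hhε (ha (d + 2))
    have h6 := mul_nonneg hC.le (ha 0)
    rw [add_mul]
    change a k ≤ _ + ε * a (d + 2)
    rcases Nat.lt_or_ge d k with hdk | hkd
    · obtain rfl : k = d + 1 := by lia
      linarith
    · have h7 := low k hkd
      have h8 : h / 4 * a (d + 1) ≤ 1 * a (d + 1) :=
        mul_le_mul_of_nonneg_right (by linarith) (ha _)
      linarith

section

variable {E F : Type*} [NormedAddCommGroup E] [NormedSpace ℝ E]
  [NormedAddCommGroup F] [NormedSpace ℝ F]

theorem Convex.norm_image_sub_sub_fderivWithin_le {s : Set E} (hs : Convex ℝ s) {g : E → F}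
    (hg : DifferentiableOn ℝ g s) {L : ℝ} (hL : 0 ≤ L) {x y : E} (hx : x ∈ s) (hy : y ∈ s)
    (hlip : ∀ w ∈ s, ‖fderivWithin ℝ g s w - fderivWithin ℝ g s x‖ ≤ L * ‖w - x‖) :
    ‖g y - g x - fderivWithin ℝ g s x (y - x)‖ ≤ L * ‖y - x‖ ^ 2 := by
  have hsub : segment ℝ x y ⊆ s := hs.segment_subset hx hy
  have := (convex_segment x y).norm_image_sub_le_of_norm_hasFDerivWithin_le' (f := g)
    (f' := fderivWithin ℝ g s) (φ := fderivWithin ℝ g s x) (C := L * ‖y - x‖)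
    (fun w hw => ((hg w (hsub hw)).hasFDerivWithinAt).mono hsub)
    (fun w hw => (hlip w (hsub hw)).trans
      (mul_le_mul_of_nonneg_left (norm_sub_le_of_mem_segment hw) hL))
    (left_mem_segment ℝ x y) (right_mem_segment ℝ x y)
  rwa [mul_assoc, ← sq] at this

theorem norm_fderivWithin_closedBall_le {g : E → F}
    (hg : DifferentiableOn ℝ g (closedBall 0 1)) {A L h : ℝ} (hL : 0 ≤ L) (hA : 0 ≤ A)
    (hh : 0 < h) (hh1 : h ≤ 1) (hbound : ∀ w ∈ closedBall (0 : E) 1, ‖g w‖ ≤ A) {z : E}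
    (hz : z ∈ closedBall (0 : E) 1)
    (hlip : ∀ w ∈ closedBall (0 : E) 1,
      ‖fderivWithin ℝ g (closedBall 0 1) w - fderivWithin ℝ g (closedBall 0 1) z‖
        ≤ L * ‖w - z‖) :
    ‖fderivWithin ℝ g (closedBall 0 1) z‖ ≤ 2 / h * A + 4 * h * L := by
  have hconv := convex_closedBall (0 : E) 1
  set D := fderivWithin ℝ g (closedBall 0 1) z
  have taylor : ∀ v : E, ‖v‖ = 1 → ‖D (h • (v - z))‖ ≤ 2 * A + 4 * h ^ 2 * L := by
    intro v hv
    have hy : z + h • (v - z) ∈ closedBall (0 : E) 1 :=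
      hconv.add_smul_sub_mem hz (by simp [hv]) ⟨hh.le, hh1⟩
    have h1 := hconv.norm_image_sub_sub_fderivWithin_le hg hL hz hy hlip
    rw [add_sub_cancel_left] at h1
    have h2 : ‖h • (v - z)‖ ≤ 2 * h := by
      rw [norm_smul, Real.norm_of_nonneg hh.le]
      have := norm_sub_le v z
      have := mem_closedBall_zero_iff.1 hz
      nlinarith
    have h3 : L * ‖h • (v - z)‖ ^ 2 ≤ L * (2 * h) ^ 2 := by gcongr
    have h4 := norm_sub_le (g (z + h • (v - z)) - g z)
      (g (z + h • (v - z)) - g z - D (h • (v - z)))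
    rw [sub_sub_cancel] at h4
    have h5 := norm_sub_le (g (z + h • (v - z))) (g z)
    linarith [hbound _ hy, hbound _ hz]
  refine D.opNorm_le_of_unit_norm (by positivity) fun v hv => ?_
  have h1 := taylor v hv
  have h2 := taylor (-v) (by rwa [norm_neg])
  have h3 : D (h • (v - z)) - D (h • (-v - z)) = (2 * h) • D v := by
    rw [← map_sub, ← map_smul]
    congr 1
    module
  have h4 := norm_sub_le (D (h • (v - z))) (D (h • (-v - z)))
  rw [h3, norm_smul, Real.norm_of_nonneg (by positivity)] at h4
  have h5 : 2 / h * A + 4 * h * L = (2 * A + 4 * h ^ 2 * L) / h := by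
    field_simp
  rw [h5, le_div_iff₀ hh]
  linarith

theorem norm_iteratedFDerivWithin_closedBall_le {f : E → F} {N : WithTop ℕ∞} {k : ℕ}
    (hf : ContDiffOn ℝ N f (closedBall 0 1)) (hk : ((k + 2 : ℕ) : WithTop ℕ∞) ≤ N)
    {A L h : ℝ} (hh : 0 < h) (hh1 : h ≤ 1)
    (hA : ∀ w ∈ closedBall (0 : E) 1, ‖iteratedFDerivWithin ℝ k f (closedBall 0 1) w‖ ≤ A)
    (hL : ∀ w ∈ closedBall (0 : E) 1,
      ‖iteratedFDerivWithin ℝ (k + 2) f (closedBall 0 1) w‖ ≤ L)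
    {z : E} (hz : z ∈ closedBall (0 : E) 1) :
    ‖iteratedFDerivWithin ℝ (k + 1) f (closedBall 0 1) z‖ ≤ 2 / h * A + 4 * h * L := by
  have hconv := convex_closedBall (0 : E) 1
  have hu : UniqueDiffOn ℝ (closedBall (0 : E) 1) :=
    uniqueDiffOn_convex hconv ⟨0, by
      rw [mem_interior_iff_mem_nhds]; exact closedBall_mem_nhds 0 one_pos⟩
  have hdiff : ∀ m : ℕ, m < k + 2 →
      DifferentiableOn ℝ (iteratedFDerivWithin ℝ m f (closedBall 0 1)) (closedBall 0 1) :=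
    fun m hm => hf.differentiableOn_iteratedFDerivWithin
      (lt_of_lt_of_le (by exact_mod_cast hm) hk) hu
  rw [← norm_fderivWithin_iteratedFDerivWithin]
  refine norm_fderivWithin_closedBall_le (hdiff k (by lia)) ((norm_nonneg _).trans (hL z hz))
    ((norm_nonneg _).trans (hA z hz)) hh hh1 hA hz fun w hw => ?_
  have h1 := hconv.norm_image_sub_le_of_norm_fderivWithin_le (hdiff (k + 1) (by lia))
    (fun x hx => (norm_fderivWithin_iteratedFDerivWithin.trans_le (hL x hx))) hz hw
  have h2 := (continuousMultilinearCurryLeftEquiv ℝ (fun _ : Fin (k + 1) => E) F).symm.dist_map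
    (fderivWithin ℝ (iteratedFDerivWithin ℝ k f (closedBall 0 1)) (closedBall 0 1) w)
    (fderivWithin ℝ (iteratedFDerivWithin ℝ k f (closedBall 0 1)) (closedBall 0 1) z)
  rw [dist_eq_norm, dist_eq_norm] at h2
  rw [iteratedFDerivWithin_succ_eq_comp_left] at h1
  exact h2.symm.trans_le h1

end

section

variable {n l : ℕ}

theorem ContinuousMultilinearMap.norm_le_sum_abs_apply_single
    (T : ContinuousMultilinearMap ℝ (fun _ : Fin l => EuclideanSpace ℝ (Fin n)) ℝ) :
    ‖T‖ ≤ ∑ m : Fin l → Fin n, |T fun i => EuclideanSpace.single (m i) 1| := by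
  refine T.opNorm_le_bound (by positivity) fun v => ?_
  have hv : v = fun i => ∑ j : Fin n, v i j • EuclideanSpace.single j (1 : ℝ) := by
    ext i j
    simp [Finset.sum_apply, Pi.single_apply]
  conv_lhs => rw [hv]
  rw [T.map_sum, Finset.sum_mul]
  refine (norm_sum_le _ _).trans (Finset.sum_le_sum fun m _ => ?_)
  rw [T.map_smul_univ, norm_smul, mul_comm, norm_prod, Real.norm_eq_abs (T _)]
  gcongr with i
  exact PiLp.norm_apply_le (v i) (m i)

theorem ContinuousMultilinearMap.sum_abs_apply_single_le
    (T : ContinuousMultilinearMap ℝ (fun _ : Fin l => EuclideanSpace ℝ (Fin n)) ℝ) :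
    ∑ m : Fin l → Fin n, |T fun i => EuclideanSpace.single (m i) 1| ≤ (n : ℝ) ^ l * ‖T‖ := by
  have h : ∀ m : Fin l → Fin n, |T fun i => EuclideanSpace.single (m i) 1| ≤ ‖T‖ := fun m => by
    simpa using T.le_opNorm fun i => EuclideanSpace.single (m i) (1 : ℝ)
  refine (Finset.sum_le_sum fun m _ => h m).trans_eq ?_
  simp

variable {f : EuclideanSpace ℝ (Fin n) → ℝ} {A : ℝ}

theorem Mder_le (hA0 : 0 ≤ A)
    (hA : ∀ z ∈ closedBall (0 : EuclideanSpace ℝ (Fin n)) 1,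
      ‖iteratedFDerivWithin ℝ l f (closedBall 0 1) z‖ ≤ A) :
    Mder n l f ≤ (n : ℝ) ^ l * A :=
  Real.iSup_le (fun z => Real.iSup_le (fun hz =>
    (ContinuousMultilinearMap.sum_abs_apply_single_le _).trans
      (mul_le_mul_of_nonneg_left (hA z hz) (by positivity))) (by positivity)) (by positivity)

theorem norm_iteratedFDerivWithin_le_Mder
    (hA : ∀ z ∈ closedBall (0 : EuclideanSpace ℝ (Fin n)) 1,
      ‖iteratedFDerivWithin ℝ l f (closedBall 0 1) z‖ ≤ A)
    {z : EuclideanSpace ℝ (Fin n)} (hz : z ∈ closedBall 0 1) :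
    ‖iteratedFDerivWithin ℝ l f (closedBall 0 1) z‖ ≤ Mder n l f := by
  have hA0 : 0 ≤ A := (norm_nonneg _).trans (hA z hz)
  refine (ContinuousMultilinearMap.norm_le_sum_abs_apply_single _).trans ?_
  have hbdd : BddAbove (Set.range fun z : EuclideanSpace ℝ (Fin n) =>
      ⨆ _ : z ∈ closedBall (0 : EuclideanSpace ℝ (Fin n)) 1, ∑ m : Fin l → Fin n,
        |iteratedFDerivWithin ℝ l f (closedBall 0 1) z
          (fun i => EuclideanSpace.single (m i) 1)|) := by
    refine ⟨(n : ℝ) ^ l * A, ?_⟩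
    rintro _ ⟨w, rfl⟩
    exact Real.iSup_le (fun hw => (ContinuousMultilinearMap.sum_abs_apply_single_le _).trans
      (mul_le_mul_of_nonneg_left (hA w hw) (by positivity))) (by positivity)
  refine le_trans ?_ (le_ciSup hbdd z)
  rw [ciSup_pos hz]

end

theorem stmt19 (n d : ℕ) (hn : 1 ≤ n) (hd : 1 ≤ d) :
    ∃ C₁ C₂ : ℝ, 0 < C₁ ∧ 0 < C₂ ∧
      ∀ f : EuclideanSpace ℝ (Fin n) → ℝ,
        ContDiffOn ℝ (d + 1) f (closedBall 0 1) →
        ∀ k, 1 ≤ k → k ≤ d →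
          Mder n k f ≤ C₁ * Mder n 0 f + C₂ * Mder n (d + 1) f := by
  obtain ⟨C, hC, hinterp⟩ := exists_interpolation_constant d 1 one_pos
  have hn0 : (0 : ℝ) < n := by exact_mod_cast hn
  refine ⟨(n : ℝ) ^ d * C, (n : ℝ) ^ d, by positivity, by positivity, fun f hf k _ hkd => ?_⟩
  let B := closedBall (0 : EuclideanSpace ℝ (Fin n)) 1
  have hu : UniqueDiffOn ℝ B :=
    uniqueDiffOn_convex (convex_closedBall _ _) ⟨0, by
      rw [mem_interior_iff_mem_nhds]; exact closedBall_mem_nhds 0 one_pos⟩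
  have : Nonempty B := ⟨⟨0, by simp [B]⟩⟩
  let a : ℕ → ℝ := fun l => ⨆ z : B, ‖iteratedFDerivWithin ℝ l f B z‖
  have ha : ∀ l, 0 ≤ a l := fun l => Real.iSup_nonneg fun _ => norm_nonneg _
  have hle : ∀ l ≤ d + 1, ∀ z ∈ B, ‖iteratedFDerivWithin ℝ l f B z‖ ≤ a l := by
    intro l hl z hz
    have hcont : ContinuousOn (iteratedFDerivWithin ℝ l f B) B :=
      hf.continuousOn_iteratedFDerivWithin (by exact_mod_cast hl) hu
    have hbdd := (isCompact_closedBall _ _).bddAbove_image hcont.norm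
    rw [Set.image_eq_range] at hbdd
    exact le_ciSup hbdd ⟨z, hz⟩
  have haM : ∀ l ≤ d + 1, a l ≤ Mder n l f := fun l hl =>
    ciSup_le fun z => norm_iteratedFDerivWithin_le_Mder (hle l hl) z.2
  have hak : a k ≤ C * a 0 + 1 * a (d + 1) := by
    refine hinterp a ha (fun j hj h hh hh1 => ciSup_le fun z => ?_) k hkd
    exact norm_iteratedFDerivWithin_closedBall_le hf
      (by exact_mod_cast (show j + 2 ≤ d + 1 by lia)) hh hh1 (hle j (by lia))
      (hle (j + 2) (by lia)) z.2
  calc Mder n k f ≤ (n : ℝ) ^ k * a k := Mder_le (ha k) (hle k (by lia))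
    _ ≤ (n : ℝ) ^ d * (C * Mder n 0 f + 1 * Mder n (d + 1) f) := by
      have h1 := haM 0 (by lia)
      have h2 := haM (d + 1) le_rfl
      have h3 : (n : ℝ) ^ k ≤ (n : ℝ) ^ d := pow_le_pow_right₀ (by exact_mod_cast hn) hkd
      have h4 : a k ≤ C * Mder n 0 f + 1 * Mder n (d + 1) f := hak.trans (by gcongr)
      exact mul_le_mul h3 h4 (ha k) (by positivity)
    _ = _ := by ring
end
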